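/- arXiv:math/0306248 — 2 statements merged into one kernel-verified Lean document; each statement's English description precedes it below -/
import Mathlib

section
/- Let β ∈ (0, 1/2^{|S|}) and ε ∈ (0, β(1−β)/(L·|S|⁴)). Let q be an irreducible transition matrix on S with stationary distribution μ, and let q̂ be a transition matrix that is (ε,β)-close to q. Let C be a nonempty proper subset of S. Then for every g ∈ G^β(C) ∪ Ĝ^β(C), |1 − p̂(g)/p(g)| ≤ (|S|+1)·β; and setting H = G^β(C) ∪ Ĝ^β(C), |(Σ_{g∈H} p̂(g))/(Σ_{g∈H} p(g)) − 1| < (|S|+1)·β. -/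
open Finset

namespace PerturbedMC

variable {S : Type*} [Fintype S] [DecidableEq S]

/-- `q` is a (row-stochastic) transition matrix on `S`: `q s t` is the probability of moving
from `s` to `t`. -/
def IsTransition (q : Matrix S S ℝ) : Prop :=
  (∀ s t, 0 ≤ q s t) ∧ ∀ s, ∑ t, q s t = 1

/-- `q` is irreducible. -/
def IsIrreducible (q : Matrix S S ℝ) : Prop :=
  ∀ s t, ∃ n : ℕ, 1 ≤ n ∧ 0 < (q ^ n) s t

/-- `μ` is a stationary distribution of `q`. -/
def IsStationary (q : Matrix S S ℝ) (μ : S → ℝ) : Prop :=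
  (∀ s, 0 ≤ μ s) ∧ (∑ s, μ s = 1) ∧ ∀ t, ∑ s, μ s * q s t = μ t

/-- The combinatorial constant `L = ∑_{n=1}^{|S|-1} C(|S|,n) · n^{|S|}`. -/
def Lconst (S : Type*) [Fintype S] : ℕ :=
  ∑ n ∈ Finset.Ico 1 (Fintype.card S), (Fintype.card S).choose n * n ^ Fintype.card S

/-- `ζ_q`: the minimal stationary outflow over nonempty proper subsets of `S`. -/
noncomputable def zeta (q : Matrix S S ℝ) (μ : S → ℝ) : ℝ :=
  sInf {x : ℝ | ∃ C : Finset S, C.Nonempty ∧ C ≠ Finset.univ ∧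
    x = ∑ s ∈ C, μ s * ∑ t ∈ Cᶜ, q s t}

/-- `ζ_q^1`: the minimal stationary outflow over nonempty proper subsets of `S₁`. -/
noncomputable def zeta1 (q : Matrix S S ℝ) (μ : S → ℝ) (S1 : Finset S) : ℝ :=
  sInf {x : ℝ | ∃ C : Finset S, C.Nonempty ∧ C ⊂ S1 ∧
    x = ∑ s ∈ C, μ s * ∑ t ∈ Cᶜ, q s t}

/-- `q̂` is `(ε,β)`-close to `q`, relative to the threshold `z` (`z = ζ_q` or `z = ζ_q^1`):
`|q̂(t|s) − q(t|s)| ≤ β·q(t|s)` whenever `μ_s q(t|s) ≥ ε·z` or `μ_s q̂(t|s) ≥ ε·z`. -/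
def IsClose (q qh : Matrix S S ℝ) (μ : S → ℝ) (z ε β : ℝ) : Prop :=
  ∀ s t, (ε * z ≤ μ s * q s t ∨ ε * z ≤ μ s * qh s t) → |qh s t - q s t| ≤ β * q s t

/-- The substochastic `C × C` restriction `q_C` of `q`. -/
def subMat (q : Matrix S S ℝ) (C : Finset S) : Matrix S S ℝ :=
  fun u v => if u ∈ C ∧ v ∈ C then q u v else 0

/-- The exit distribution `Q_{s,q}(t|C) = Σ_{n≥0} Σ_{u∈C} (q_C^n)(u|s)·q(t|u)`. -/
noncomputable def exitProb (q : Matrix S S ℝ) (C : Finset S) (s t : S) : ℝ :=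
  ∑' n : ℕ, ∑ u ∈ C, ((subMat q C ^ n : Matrix S S ℝ) s u) * q u t

/-- The expected exit time `E_{s,q}[T_{C̄}] = Σ_{n≥0} Σ_{u∈C} (q_C^n)(u|s) ∈ [0,∞]`. -/
noncomputable def expExit (q : Matrix S S ℝ) (C : Finset S) (s : S) : ENNReal :=
  ∑' n : ℕ, ENNReal.ofReal (∑ u ∈ C, (subMat q C ^ n : Matrix S S ℝ) s u)

/-- `g` has a cycle within `C`. -/
def HasCycle (C : Finset S) (g : S → S) : Prop :=
  ∃ (k : ℕ) (f : ℕ → S), 0 < k ∧ f k = f 0 ∧ (∀ i < k, f i ∈ C) ∧ ∀ i < k, g (f i) = f (i + 1)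

/-- `g` is a `C`-graph (the values of `g` outside `C` are irrelevant). -/
def IsCGraph (C : Finset S) (g : S → S) : Prop := ¬ HasCycle C g

/-- `s` leads to `t` along `g`: `t` is the first state outside `C` on the `g`-orbit of `s`. -/
def LeadsTo (C : Finset S) (g : S → S) (s t : S) : Prop :=
  ∃ n : ℕ, g^[n] s = t ∧ t ∉ C ∧ ∀ m < n, g^[m] s ∈ C

/-- The weight `p(g) = Π_{s∈C} q(g(s)|s)` of a `C`-graph under `q`. -/
def wt (q : Matrix S S ℝ) (C : Finset S) (g : S → S) : ℝ := ∏ s ∈ C, q s (g s)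

/-- `G(C)`: the canonical representatives of `C`-graphs, namely the maps `S → S` that are
`C`-graphs and are the identity outside `C`. -/
noncomputable def Gset (C : Finset S) : Finset (S → S) :=
  @Finset.filter _ (fun g => IsCGraph C g ∧ ∀ s ∉ C, g s = s) (Classical.decPred _) Finset.univ

/-- `G_{s,t}(C)`: the `C`-graphs along which `s` leads to `t`. -/
noncomputable def GsetLead (C : Finset S) (s t : S) : Finset (S → S) :=
  @Finset.filter _ (fun g => LeadsTo C g s t) (Classical.decPred _) (Gset C)

/-- `g` is an `η`-maximal `C`-graph under `q`: `p(g) ≥ η · max_{g' ∈ G(C)} p(g')`. -/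
def IsMaximal (q : Matrix S S ℝ) (C : Finset S) (η : ℝ) (g : S → S) : Prop :=
  IsCGraph C g ∧ ∀ g', IsCGraph C g' → η * wt q C g' ≤ wt q C g

/-- `H = G^β(C) ∪ Ĝ^β(C)` as a finset of canonical representatives. -/
noncomputable def Hset (q qh : Matrix S S ℝ) (C : Finset S) (β : ℝ) : Finset (S → S) :=
  @Finset.filter _ (fun g => IsMaximal q C β g ∨ IsMaximal qh C β g)
    (Classical.decPred _) (Gset C)

/-- The mixing hypothesis with parameter `a` on `S₁`: for all `s,t ∈ S₁`, the probability
that the chain started at `s`, from its first step onward, reaches `t` before reaching any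
state of `S \ S₁`, is at least `a`. -/
def Mixing (q : Matrix S S ℝ) (S1 : Finset S) (a : ℝ) : Prop :=
  ∀ s ∈ S1, ∀ t ∈ S1,
    a ≤ q s t + ∑ u ∈ S1.erase t, q s u * exitProb q (S1.erase t) u t

/-- `R` is a recurrent class for `q`. -/
def IsRecClass (q : Matrix S S ℝ) (R : Finset S) : Prop :=
  (∀ s ∈ R, ∑ t ∈ Rᶜ, q s t = 0) ∧
    ∀ s ∈ R, ∀ t ∈ R, ∃ n : ℕ, 1 ≤ n ∧ 0 < (q ^ n) s t

theorem exists_iterate_eq_of_eqOn_ne {V : Type*} {f f' : V → V} {r : V} (h : ∀ v, v ≠ r → f v = f' v) (v : V)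
    (hv : ∃ n, f^[n] v = r) : ∃ n, f'^[n] v = r := by
  obtain ⟨n, hn⟩ := hv
  induction n generalizing v with
  | zero => exact ⟨0, hn⟩
  | succ n ih =>
    by_cases hvr : v = r
    · exact ⟨0, hvr⟩
    · obtain ⟨m, hm⟩ := ih (f v) hn
      exact ⟨m + 1, by rwa [Function.iterate_succ_apply, ← h v hvr]⟩

section Arborescence

variable {V : Type*} [Fintype V] [DecidableEq V]

/-- The maps all of whose orbits reach `r`. -/
noncomputable def reachingMaps (r : V) : Finset (V → V) :=
  @Finset.filter _ (fun f => ∀ v, ∃ n, f^[n] v = r) (Classical.decPred _) Finset.univ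

/-- The arborescences rooted at `r`, as maps fixing `r` all of whose orbits reach `r`. -/
noncomputable def arborescences (r : V) : Finset (V → V) :=
  @Finset.filter _ (fun f => f r = r ∧ ∀ v, ∃ n, f^[n] v = r) (Classical.decPred _) Finset.univ

theorem mem_reachingMaps {r : V} {f : V → V} :
    f ∈ reachingMaps r ↔ ∀ v, ∃ n, f^[n] v = r := by
  simp [reachingMaps]

theorem mem_arborescences {r : V} {f : V → V} :
    f ∈ arborescences r ↔ f r = r ∧ ∀ v, ∃ n, f^[n] v = r := by
  simp [arborescences]

/-- The total weight of the arborescences rooted at `r`. -/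
noncomputable def arbWeight (w : V → V → ℝ) (r : V) : ℝ :=
  ∑ f ∈ arborescences r, ∏ v ∈ univ.erase r, w v (f v)

theorem prod_le_arbWeight {w : V → V → ℝ} (hw : ∀ a b, 0 ≤ w a b) {r : V} {f : V → V}
    (hf : f ∈ arborescences r) : ∏ v ∈ univ.erase r, w v (f v) ≤ arbWeight w r :=
  single_le_sum (f := fun f => ∏ v ∈ univ.erase r, w v (f v))
    (fun _ _ => prod_nonneg fun _ _ => hw _ _) hf

theorem prod_update_apply (w : V → V → ℝ) (f : V → V) (r x : V) :
    ∏ v, w v (Function.update f r x v) = (∏ v ∈ univ.erase r, w v (f v)) * w r x := by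
  rw [← Finset.prod_erase_mul univ _ (mem_univ r), Function.update_self]
  congr 1
  exact Finset.prod_congr rfl fun v hv => by rw [Function.update_of_ne (ne_of_mem_erase hv)]

omit [Fintype V] in
theorem update_mem_reachingMaps {r x : V} {f : V → V} (h : ∀ v, ∃ n, f^[n] v = r) (v : V) :
    ∃ n, (Function.update f r x)^[n] v = r :=
  exists_iterate_eq_of_eqOn_ne (fun _ hu => (Function.update_of_ne hu _ _).symm) v (h v)

theorem arbWeight_mul_sum (w : V → V → ℝ) (t : V) :
    arbWeight w t * ∑ v, w t v = ∑ F ∈ reachingMaps t, ∏ v, w v (F v) := by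
  rw [arbWeight, Finset.sum_mul_sum, ← Finset.sum_product']
  refine Finset.sum_bij' (fun x _ => Function.update x.1 t x.2)
    (fun F _ => (Function.update F t t, F t)) ?_ ?_ ?_ ?_ ?_
  · rintro ⟨f, x⟩ hx
    simp only [mem_product, mem_univ, and_true, mem_arborescences] at hx
    exact mem_reachingMaps.2 (update_mem_reachingMaps hx.2)
  · intro F hF
    simp only [mem_product, mem_univ, and_true, mem_arborescences, Function.update_self, true_and]
    exact update_mem_reachingMaps (mem_reachingMaps.1 hF)
  · rintro ⟨f, x⟩ hx
    simp only [mem_product, mem_univ, and_true, mem_arborescences] at hx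
    simp only [Function.update_idem, Function.update_self, Prod.mk.injEq, and_true]
    exact Function.update_eq_self_iff.2 hx.1.symm
  · intro F hF
    simp
  · rintro ⟨f, x⟩ hx
    exact (prod_update_apply w f t x).symm

omit [Fintype V] in
theorem mem_periodicPts_of_update {s t : V} {f : V → V} (h : ∀ v, ∃ n, f^[n] v = s) :
    s ∈ Function.periodicPts (Function.update f s t) := by
  obtain ⟨n, hn⟩ := update_mem_reachingMaps (x := t) h t
  refine Function.mk_mem_periodicPts (n := n + 1) n.succ_pos ?_
  rw [Function.IsPeriodicPt, Function.IsFixedPt, Function.iterate_succ_apply,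
    Function.update_self, hn]

theorem sum_arbWeight_mul (w : V → V → ℝ) (t : V) :
    ∑ s, arbWeight w s * w s t = ∑ F ∈ reachingMaps t, ∏ v, w v (F v) := by
  simp only [arbWeight, Finset.sum_mul]
  rw [Finset.sum_sigma']
  refine Finset.sum_bij (fun x _ => Function.update x.2 x.1 t) ?_ ?_ ?_ ?_
  · rintro ⟨s, f⟩ hx
    simp only [mem_sigma, mem_univ, true_and, mem_arborescences] at hx
    refine mem_reachingMaps.2 fun v => ?_
    obtain ⟨n, hn⟩ := update_mem_reachingMaps (x := t) hx.2 v
    exact ⟨n + 1, by rw [Function.iterate_succ_apply', hn, Function.update_self]⟩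
  · rintro ⟨s, f⟩ hx ⟨s', f'⟩ hx' h
    simp only [mem_sigma, mem_univ, true_and, mem_arborescences] at hx hx'
    dsimp only at h
    have hs := mem_periodicPts_of_update (t := t) hx.2
    have hs' := mem_periodicPts_of_update (t := t) hx'.2
    rw [← h] at hs'
    have hss : s = s' := by
      refine (Function.bijOn_periodicPts _).injOn hs hs' ?_
      rw [Function.update_self, h, Function.update_self]
    subst hss
    have : f = f' := by
      funext v
      by_cases hv : v = s
      · rw [hv, hx.1, hx'.1]
      · simpa [hv] using congrFun h v
    rw [this]
  · intro F hF
    rw [mem_reachingMaps] at hF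
    obtain ⟨n, hn⟩ := hF (F t)
    have ht : t ∈ Function.periodicPts F := Function.mk_mem_periodicPts n.succ_pos hn
    obtain ⟨s, hs, hst⟩ := (Function.bijOn_periodicPts F).surjOn ht
    obtain ⟨k, hk, hks⟩ := hs
    obtain ⟨k, rfl⟩ := Nat.exists_eq_succ_of_ne_zero hk.ne'
    refine ⟨⟨s, Function.update F s s⟩, ?_, ?_⟩
    · simp only [mem_sigma, mem_univ, true_and, mem_arborescences, Function.update_self]
      refine update_mem_reachingMaps fun v => ?_
      obtain ⟨m, hm⟩ := hF v
      refine ⟨k + m, ?_⟩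
      rw [Function.iterate_add_apply, hm, ← hst]
      exact hks
    · simp only [Function.update_idem]
      exact Function.update_eq_self_iff.2 hst.symm
  · rintro ⟨s, f⟩ hx
    exact (prod_update_apply w f s t).symm

/-- In a connected circulation, the total weight of the arborescences does not depend on the
root. -/
theorem arbWeight_eq_of_balanced {w : V → V → ℝ} (hw : ∀ a b, 0 ≤ w a b)
    (hbal : ∀ a, ∑ b, w a b = ∑ b, w b a)
    (hcut : ∀ B : Finset V, B.Nonempty → B ≠ univ → ∃ a ∉ B, ∃ b ∈ B, 0 < w a b) (r s : V) :
    arbWeight w r = arbWeight w s := by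
  obtain ⟨m, -, hm⟩ := Finset.exists_max_image univ (arbWeight w) ⟨r, mem_univ r⟩
  suffices h : univ.filter (fun v => arbWeight w v = arbWeight w m) = univ by
    have h' : ∀ v, arbWeight w v = arbWeight w m := fun v =>
      (mem_filter.1 (h ▸ mem_univ v : v ∈ univ.filter _)).2
    rw [h' r, h' s]
  by_contra hne
  obtain ⟨a, ha, b, hb, hab⟩ := hcut _ ⟨m, by simp⟩ hne
  simp only [mem_filter, mem_univ, true_and] at ha hb
  have hzero : ∑ v, (arbWeight w b - arbWeight w v) * w v b = 0 := by
    simp only [sub_mul, Finset.sum_sub_distrib, sum_arbWeight_mul]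
    rw [← arbWeight_mul_sum, ← Finset.mul_sum, hbal, sub_self]
  have hnn : ∀ v ∈ univ, 0 ≤ (arbWeight w b - arbWeight w v) * w v b := fun v hv =>
    mul_nonneg (sub_nonneg.2 (hb ▸ hm v hv)) (hw v b)
  have := (Finset.sum_eq_zero_iff_of_nonneg hnn).1 hzero a (mem_univ a)
  rcases mul_eq_zero.1 this with h | h
  · exact ha (by linarith)
  · exact hab.ne' h


end Arborescence

theorem exists_notMem_of_ne_univ {α : Type*} [Fintype α] {B : Finset α} (h : B ≠ univ) :
    ∃ a, a ∉ B := by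
  by_contra! h'
  exact h (eq_univ_iff_forall.2 h')

omit [Fintype S] [DecidableEq S] in
theorem hasCycle_of_iterate_eq {C : Finset S} {g : S → S} {v : S} (hv : ∀ n, g^[n] v ∈ C)
    {i j : ℕ} (hij : i < j) (h : g^[i] v = g^[j] v) : HasCycle C g := by
  refine ⟨j - i, fun m => g^[m + i] v, Nat.sub_pos_of_lt hij, ?_, fun m _ => hv _, fun m _ => ?_⟩
  · simp [Nat.sub_add_cancel hij.le, h]
  · dsimp only
    rw [← Function.iterate_succ_apply' g, Nat.succ_eq_add_one, Nat.add_right_comm]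

omit [DecidableEq S] in
/-- A map is a `C`-graph iff all of its orbits leave `C`. -/
theorem isCGraph_iff {C : Finset S} {g : S → S} : IsCGraph C g ↔ ∀ v, ∃ n, g^[n] v ∉ C := by
  constructor
  · intro h v
    by_contra! hv
    obtain ⟨i, j, hne, hij⟩ := Finite.exists_ne_map_eq_of_infinite (fun n : ℕ => g^[n] v)
    rcases hne.lt_or_gt with hlt | hlt
    · exact h (hasCycle_of_iterate_eq hv hlt hij)
    · exact h (hasCycle_of_iterate_eq hv hlt hij.symm)
  · rintro h ⟨k, f, hk, hcyc, hmem, hstep⟩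
    have hf : ∀ i ≤ k, g^[i] (f 0) = f i := by
      intro i
      induction i with
      | zero => intro _; rfl
      | succ i ih =>
        intro hi
        rw [Function.iterate_succ_apply', ih (by omega), hstep i (by omega)]
    have hper : Function.IsPeriodicPt g k (f 0) := (hf k le_rfl).trans hcyc
    obtain ⟨n, hn⟩ := h (f 0)
    rw [← hper.iterate_mod_apply, hf _ (Nat.mod_lt _ hk).le] at hn
    exact hn (hmem _ (Nat.mod_lt _ hk))

section Collapse

/-- The projection of `S` collapsing the complement of `D` to the single point `none`. -/
def collapseProj (D : Finset S) (s : S) : Option {x // x ∈ D} :=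
  if h : s ∈ D then some ⟨s, h⟩ else none

omit [Fintype S] in
theorem collapseProj_of_mem {D : Finset S} {s : S} (h : s ∈ D) :
    collapseProj D s = some ⟨s, h⟩ := dif_pos h

omit [Fintype S] in
theorem collapseProj_eq_none {D : Finset S} {s : S} : collapseProj D s = none ↔ s ∉ D := by
  simp [collapseProj]

omit [Fintype S] in
theorem collapseProj_eq_some {D : Finset S} {s : S} {x : {x // x ∈ D}} :
    collapseProj D s = some x ↔ s = x := by
  by_cases h : s ∈ D
  · simp [collapseProj, h, Subtype.ext_iff]
  · simp only [collapseProj, h, dif_neg, not_false_eq_true, reduceCtorEq, false_iff]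
    rintro rfl
    exact h x.2

/-- The weights induced on the quotient of `S` by the complement of `D`. -/
def collapse (w : S → S → ℝ) (D : Finset S) (a b : Option {x // x ∈ D}) : ℝ :=
  ∑ s with collapseProj D s = a, ∑ t with collapseProj D t = b, w s t

theorem collapse_some (w : S → S → ℝ) (D : Finset S) (x : {x // x ∈ D})
    (b : Option {x // x ∈ D}) :
    collapse w D (some x) b = ∑ t with collapseProj D t = b, w x t := by
  simp only [collapse, collapseProj_eq_some]
  rw [Finset.filter_eq' univ (x : S), if_pos (mem_univ _), sum_singleton]

theorem collapse_some_some (w : S → S → ℝ) (D : Finset S) (x y : {x // x ∈ D}) :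
    collapse w D (some x) (some y) = w x y := by
  rw [collapse_some]
  simp only [collapseProj_eq_some]
  rw [Finset.filter_eq' univ (y : S), if_pos (mem_univ _), sum_singleton]

theorem collapse_none_some (w : S → S → ℝ) (D : Finset S) (y : {x // x ∈ D}) :
    collapse w D none (some y) = ∑ s ∈ Dᶜ, w s y := by
  simp only [collapse, collapseProj_eq_some, collapseProj_eq_none]
  refine Finset.sum_congr (by ext; simp) fun s _ => ?_
  rw [Finset.filter_eq' univ (y : S), if_pos (mem_univ _), sum_singleton]

theorem collapse_nonneg {w : S → S → ℝ} (hw : ∀ s t, 0 ≤ w s t) (D : Finset S)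
    (a b : Option {x // x ∈ D}) : 0 ≤ collapse w D a b :=
  sum_nonneg fun _ _ => sum_nonneg fun _ _ => hw _ _

theorem collapse_balanced {w : S → S → ℝ} (hbal : ∀ s, ∑ t, w s t = ∑ t, w t s) (D : Finset S)
    (a : Option {x // x ∈ D}) : ∑ b, collapse w D a b = ∑ b, collapse w D b a := by
  have h : ∑ b, collapse w D b a = ∑ s, ∑ t with collapseProj D t = a, w s t :=
    Finset.sum_fiberwise univ (collapseProj D) _
  rw [h, Finset.sum_comm]
  simp only [collapse]
  rw [Finset.sum_comm]
  refine Finset.sum_congr rfl fun s _ => ?_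
  rw [Finset.sum_fiberwise univ (collapseProj D), hbal]

theorem collapse_cut {w : S → S → ℝ} (hw : ∀ s t, 0 ≤ w s t) {D : Finset S}
    (hD : D ≠ univ)
    (hcut : ∀ B : Finset S, B.Nonempty → B ≠ univ → 0 < ∑ s ∈ B, ∑ t ∈ Bᶜ, w s t)
    {B : Finset (Option {x // x ∈ D})} (hB : B.Nonempty) (hB' : B ≠ univ) :
    ∃ a ∉ B, ∃ b ∈ B, 0 < collapse w D a b := by
  have hsurj : Function.Surjective (collapseProj D) := by
    rintro (_ | x)
    · obtain ⟨r, hr⟩ := exists_notMem_of_ne_univ hD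
      exact ⟨r, collapseProj_eq_none.2 hr⟩
    · exact ⟨x, collapseProj_eq_some.2 rfl⟩
  have hpos := hcut (univ.filter fun s => collapseProj D s ∉ B) ?_ ?_
  · obtain ⟨s, hs, hs'⟩ := Finset.exists_lt_of_sum_lt (f := fun _ => (0 : ℝ)) (by simpa using hpos)
    obtain ⟨t, ht, hst⟩ := Finset.exists_lt_of_sum_lt (f := fun _ => (0 : ℝ)) (by simpa using hs')
    simp only [mem_filter, mem_univ, true_and] at hs ht
    refine ⟨_, hs, _, ht, hst.trans_le ?_⟩
    calc w s t ≤ ∑ t' with collapseProj D t' = collapseProj D t, w s t' :=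
          single_le_sum (f := fun t' => w s t') (fun _ _ => hw _ _) (by simp)
      _ ≤ _ := single_le_sum
          (f := fun s' => ∑ t' with collapseProj D t' = collapseProj D t, w s' t')
          (fun _ _ => sum_nonneg fun _ _ => hw _ _) (by simp)
  · obtain ⟨a, ha⟩ := exists_notMem_of_ne_univ hB'
    obtain ⟨s, rfl⟩ := hsurj a
    exact ⟨s, by simpa using ha⟩
  · obtain ⟨b, hb⟩ := hB
    obtain ⟨t, rfl⟩ := hsurj b
    intro h
    have := (mem_filter.1 (h ▸ mem_univ t : t ∈ univ.filter _)).2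
    exact this hb

theorem arbWeight_collapse_none_le {w : Matrix S S ℝ} {D : Finset S} {P : ℝ} (hP0 : 0 ≤ P)
    (hP : ∀ h, IsCGraph D h → wt w D h ≤ P) :
    arbWeight (collapse w D) none ≤ ((Fintype.card S - 1 : ℕ) : ℝ) ^ D.card * P := by
  have hprod : ∀ f : Option {x // x ∈ D} → Option {x // x ∈ D},
      ∏ v ∈ univ.erase none, collapse w D v (f v) =
        ∑ p ∈ Fintype.piFinset fun x : {x // x ∈ D} =>
          univ.filter fun t => collapseProj D t = f (some x), ∏ x : {x // x ∈ D}, w x (p x) := by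
    intro f
    have hu : (univ : Finset (Option {x // x ∈ D})).erase none =
        univ.map Function.Embedding.some := by
      ext (_ | x) <;> simp
    rw [hu, Finset.prod_map, ← Finset.prod_univ_sum]
    exact Finset.prod_congr rfl fun x _ => collapse_some w D x _
  simp only [arbWeight, hprod]
  rw [Finset.sum_sigma']
  set T := (arborescences (none : Option {x // x ∈ D})).sigma fun f =>
    Fintype.piFinset fun x : {x // x ∈ D} =>
      univ.filter fun t => collapseProj D t = f (some x) with hT
  have hmem : ∀ y ∈ T, (y.1 none = none ∧ ∀ v, ∃ n, y.1^[n] v = none) ∧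
      ∀ x, collapseProj D (y.2 x) = y.1 (some x) := by
    intro y hy
    simpa only [hT, mem_sigma, mem_arborescences, Fintype.mem_piFinset, mem_filter, mem_univ,
      true_and] using hy
  have hcard : T.card ≤ (Fintype.card S - 1) ^ D.card := by
    have hc : (Fintype.piFinset fun x : {x // x ∈ D} => (univ : Finset S).erase x).card =
        (Fintype.card S - 1) ^ D.card := by
      simp [Fintype.card_piFinset]
    rw [← hc]
    refine Finset.card_le_card_of_injOn (fun y => y.2) ?_ ?_
    · intro y hy
      obtain ⟨⟨-, h1⟩, h2⟩ := hmem y hy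
      refine mem_coe.2 (Fintype.mem_piFinset.2 fun x => mem_erase.2 ⟨fun hx => ?_, mem_univ _⟩)
      have hfix : Function.IsFixedPt y.1 (some x) := by
        rw [Function.IsFixedPt, ← h2 x, collapseProj_eq_some]
        exact hx
      obtain ⟨n, hn⟩ := h1 (some x)
      rw [hfix.iterate n] at hn
      cases hn
    · rintro ⟨f, p⟩ hy ⟨f', p'⟩ hy' h
      obtain ⟨⟨h0, -⟩, h2⟩ := hmem _ hy
      obtain ⟨⟨h0', -⟩, h2'⟩ := hmem _ hy'
      dsimp only at h h0 h2 h0' h2'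
      subst h
      have : f = f' := by
        funext v
        rcases v with _ | x
        · rw [h0, h0']
        · rw [← h2, ← h2']
      rw [this]
  calc _ ≤ ∑ y ∈ T, P := by
        refine Finset.sum_le_sum fun y hy => ?_
        obtain ⟨⟨-, h1⟩, h2⟩ := hmem y hy
        set h : S → S := fun v => if hv : v ∈ D then y.2 ⟨v, hv⟩ else v with hh
        have hwt : ∏ x : {x // x ∈ D}, w x (y.2 x) = wt w D h := by
          rw [wt, ← Finset.prod_coe_sort D fun v => w v (h v)]
          refine Finset.prod_congr rfl fun x _ => ?_
          simp [hh]
        rw [hwt]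
        refine hP h (isCGraph_iff.2 fun v => ?_)
        obtain ⟨n, hn⟩ := h1 (collapseProj D v)
        induction n generalizing v with
        | zero => exact ⟨0, collapseProj_eq_none.1 hn⟩
        | succ n ih =>
          by_cases hv : v ∈ D
          · rw [Function.iterate_succ_apply, collapseProj_of_mem hv, ← h2] at hn
            obtain ⟨m, hm⟩ := ih (h v) (by simpa [hh, hv] using hn)
            exact ⟨m + 1, hm⟩
          · exact ⟨0, hv⟩
    _ = (T.card : ℝ) * P := by rw [sum_const, nsmul_eq_mul]
    _ ≤ _ := by
        gcongr
        exact_mod_cast hcard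

theorem prod_mul_le_arbWeight_collapse {w : S → S → ℝ} (hw : ∀ s t, 0 ≤ w s t) {D : Finset S}
    {g : S → S} {s : S} (hs : s ∈ D) (hgD : ∀ v ∈ D, v ≠ s → g v ∈ D)
    (hgs : ∀ v ∈ D, ∃ n, g^[n] v = s) {b : S} (hb : b ∈ D) :
    (∏ v ∈ D.erase s, w v (g v)) * ∑ u ∈ Dᶜ, w u b ≤
      arbWeight (collapse w D) (some ⟨s, hs⟩) := by
  set f : Option {x // x ∈ D} → Option {x // x ∈ D} := fun o =>
    o.elim (some ⟨b, hb⟩) fun v => if v = s then some ⟨s, hs⟩ else collapseProj D (g v) with hf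
  have hreach : ∀ v (hv : v ∈ D), ∃ n, f^[n] (some ⟨v, hv⟩) = some ⟨s, hs⟩ := by
    intro v hv
    obtain ⟨n, hn⟩ := hgs v hv
    induction n generalizing v with
    | zero => exact ⟨0, by simpa using hn⟩
    | succ n ih =>
      by_cases hvs : v = s
      · exact ⟨0, by simpa using hvs⟩
      · obtain ⟨m, hm⟩ := ih (g v) (hgD v hv hvs) hn
        refine ⟨m + 1, ?_⟩
        rw [Function.iterate_succ_apply, ← hm, ← collapseProj_of_mem (hgD v hv hvs)]
        simp [hf, hvs]
  have hfmem : f ∈ arborescences (some ⟨s, hs⟩) := by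
    refine mem_arborescences.2 ⟨by simp [hf], ?_⟩
    rintro (_ | ⟨v, hv⟩)
    · obtain ⟨n, hn⟩ := hreach b hb
      refine ⟨n + 1, ?_⟩
      rw [Function.iterate_succ_apply]
      exact hn
    · exact hreach v hv
  have hfnone : f none = some ⟨b, hb⟩ := rfl
  have hu : (univ : Finset (Option {x // x ∈ D})).erase (some ⟨s, hs⟩) =
      insertNone (univ.erase ⟨s, hs⟩) := by
    ext (_ | x) <;> simp
  have hval : ∏ v ∈ univ.erase (some ⟨s, hs⟩), collapse w D v (f v) =
      (∏ v ∈ D.erase s, w v (g v)) * ∑ u ∈ Dᶜ, w u b := by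
    rw [hu, Finset.prod_insertNone, mul_comm, hfnone, collapse_none_some]
    congr 1
    refine Finset.prod_bij (fun x _ => x.1) ?_ ?_ ?_ ?_
    · intro x hx
      have := ne_of_mem_erase hx
      exact mem_erase.2 ⟨fun h => this (Subtype.ext h), x.2⟩
    · intro x _ y _ h
      exact Subtype.ext h
    · intro v hv
      have hv' := mem_erase.1 hv
      exact ⟨⟨v, hv'.2⟩, mem_erase.2 ⟨fun h => hv'.1 (congrArg Subtype.val h), mem_univ _⟩, rfl⟩
    · intro x hx
      have hxs : (x : S) ≠ s := fun h => ne_of_mem_erase hx (Subtype.ext h)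
      have : f (some x) = some ⟨g x, hgD x x.2 hxs⟩ := by
        simp [hf, hxs, collapseProj_of_mem (hgD x x.2 hxs)]
      rw [this, collapse_some_some]
  rw [← hval]
  exact prod_le_arbWeight (collapse_nonneg hw D) hfmem

/-- In a circulation all of whose cuts are at least `z`, a spanning tree of `D` is, up to the
factor `z`, not much heavier than the heaviest `D`-graph. -/
theorem cut_mul_prod_le {w : Matrix S S ℝ} (hw : ∀ s t, 0 ≤ w s t)
    (hbal : ∀ s, ∑ t, w s t = ∑ t, w t s) {z : ℝ} (hz : 0 < z)
    (hcut : ∀ B : Finset S, B.Nonempty → B ≠ univ → z ≤ ∑ s ∈ B, ∑ t ∈ Bᶜ, w s t)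
    {D : Finset S} (hD : D ≠ univ) {g : S → S} {s : S} (hs : s ∈ D)
    (hgD : ∀ v ∈ D, v ≠ s → g v ∈ D) (hgs : ∀ v ∈ D, ∃ n, g^[n] v = s) {P : ℝ} (hP0 : 0 ≤ P)
    (hP : ∀ h, IsCGraph D h → wt w D h ≤ P) :
    z * ∏ v ∈ D.erase s, w v (g v) ≤ ((Fintype.card S - 1 : ℕ) : ℝ) ^ Fintype.card S * P := by
  obtain ⟨r, hr⟩ := exists_notMem_of_ne_univ hD
  have hDlt : D.card + 1 ≤ Fintype.card S := Finset.card_lt_univ_of_notMem hr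
  have hNpos : 0 < D.card := Finset.card_pos.2 ⟨s, hs⟩
  have hin : z ≤ ∑ b ∈ D, ∑ u ∈ Dᶜ, w u b := by
    rw [Finset.sum_comm]
    have := hcut Dᶜ ⟨r, mem_compl.2 hr⟩ (by simpa using Finset.ne_empty_of_mem hs)
    rwa [compl_compl] at this
  have hroot : arbWeight (collapse w D) (some ⟨s, hs⟩) = arbWeight (collapse w D) none :=
    arbWeight_eq_of_balanced (collapse_nonneg hw D) (collapse_balanced hbal D)
      (fun B hB hB' => collapse_cut hw hD
        (fun B hB hB' => hz.trans_le (hcut B hB hB')) hB hB') _ _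
  have hτ : 0 ≤ ∏ v ∈ D.erase s, w v (g v) := prod_nonneg fun _ _ => hw _ _
  calc z * ∏ v ∈ D.erase s, w v (g v)
      ≤ (∑ b ∈ D, ∑ u ∈ Dᶜ, w u b) * ∏ v ∈ D.erase s, w v (g v) := by gcongr
    _ = ∑ b ∈ D, (∏ v ∈ D.erase s, w v (g v)) * ∑ u ∈ Dᶜ, w u b := by
        rw [mul_comm, Finset.mul_sum]
    _ ≤ ∑ b ∈ D, ((Fintype.card S - 1 : ℕ) : ℝ) ^ D.card * P := by
        refine Finset.sum_le_sum fun b hb => ?_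
        refine (prod_mul_le_arbWeight_collapse hw hs hgD hgs hb).trans ?_
        rw [hroot]
        exact arbWeight_collapse_none_le hP0 hP
    _ = (D.card : ℝ) * ((Fintype.card S - 1 : ℕ) : ℝ) ^ D.card * P := by
        rw [sum_const, nsmul_eq_mul, mul_assoc]
    _ ≤ ((Fintype.card S - 1 : ℕ) : ℝ) ^ Fintype.card S * P := by
        gcongr
        have h1 : D.card ≤ Fintype.card S - 1 := by omega
        have h2 : D.card * (Fintype.card S - 1) ^ D.card ≤
            (Fintype.card S - 1) ^ Fintype.card S :=
          calc D.card * (Fintype.card S - 1) ^ D.card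
              ≤ (Fintype.card S - 1) * (Fintype.card S - 1) ^ D.card := by gcongr
            _ = (Fintype.card S - 1) ^ (D.card + 1) := by rw [pow_succ, mul_comm]
            _ ≤ _ := Nat.pow_le_pow_right (by omega) hDlt
        exact_mod_cast h2

end Collapse

section Basin

/-- The states of `C` whose `g`-orbit reaches `s` before leaving `C`. -/
noncomputable def basin (C : Finset S) (g : S → S) (s : S) : Finset S :=
  @Finset.filter _ (fun v => ∃ n, g^[n] v = s ∧ ∀ m ≤ n, g^[m] v ∈ C) (Classical.decPred _) C

omit [Fintype S] [DecidableEq S] in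
theorem mem_basin {C : Finset S} {g : S → S} {s v : S} :
    v ∈ basin C g s ↔ ∃ n, g^[n] v = s ∧ ∀ m ≤ n, g^[m] v ∈ C := by
  simp only [basin, mem_filter, and_iff_right_iff_imp]
  rintro ⟨n, -, h⟩
  exact h 0 n.zero_le

omit [Fintype S] [DecidableEq S] in
theorem basin_subset (C : Finset S) (g : S → S) (s : S) : basin C g s ⊆ C := by
  intro v hv
  obtain ⟨n, -, h⟩ := mem_basin.1 hv
  exact h 0 n.zero_le

omit [Fintype S] [DecidableEq S] in
theorem self_mem_basin {C : Finset S} {g : S → S} {s : S} (hs : s ∈ C) : s ∈ basin C g s :=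
  mem_basin.2 ⟨0, rfl, fun m hm => by simpa [Nat.le_zero.1 hm] using hs⟩

omit [Fintype S] [DecidableEq S] in
theorem map_mem_basin {C : Finset S} {g : S → S} {s v : S} (hv : v ∈ basin C g s) (hvs : v ≠ s) :
    g v ∈ basin C g s := by
  obtain ⟨n, hn, h⟩ := mem_basin.1 hv
  cases n with
  | zero => exact absurd hn hvs
  | succ n => exact mem_basin.2 ⟨n, hn, fun m hm => h (m + 1) (by omega)⟩

omit [Fintype S] [DecidableEq S] in
theorem mem_basin_of_map_mem {C : Finset S} {g : S → S} {s v : S} (hv : v ∈ C)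
    (h : g v ∈ basin C g s) : v ∈ basin C g s := by
  obtain ⟨n, hn, h⟩ := mem_basin.1 h
  refine mem_basin.2 ⟨n + 1, hn, fun m hm => ?_⟩
  cases m with
  | zero => exact hv
  | succ m => exact h m (by omega)

omit [DecidableEq S] in
theorem basin_ne_univ {C : Finset S} (hC : C ≠ univ) (g : S → S) (s : S) : basin C g s ≠ univ := by
  obtain ⟨r, hr⟩ := exists_notMem_of_ne_univ hC
  intro h
  exact hr (basin_subset C g s (by rw [h]; exact mem_univ r))

theorem isCGraph_piecewise_basin {C : Finset S} {g h : S → S} {s : S} (hg : IsCGraph C g)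
    (hh : IsCGraph (basin C g s) h) : IsCGraph C ((basin C g s).piecewise h g) := by
  rw [isCGraph_iff] at hg hh ⊢
  set k := (basin C g s).piecewise h g with hk
  have houtside : ∀ v, v ∉ basin C g s → ∃ n, k^[n] v ∉ C := by
    intro v hv
    obtain ⟨n, hn⟩ := hg v
    induction n generalizing v with
    | zero => exact ⟨0, hn⟩
    | succ n ih =>
      by_cases hvC : v ∈ C
      · obtain ⟨m, hm⟩ := ih (g v) (fun h => hv (mem_basin_of_map_mem hvC h)) hn
        refine ⟨m + 1, ?_⟩
        rwa [Function.iterate_succ_apply, hk, piecewise_eq_of_notMem _ _ _ hv]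
      · exact ⟨0, hvC⟩
  intro v
  obtain ⟨n, hn⟩ := hh v
  induction n generalizing v with
  | zero => exact houtside v hn
  | succ n ih =>
    by_cases hv : v ∈ basin C g s
    · obtain ⟨m, hm⟩ := ih (h v) hn
      refine ⟨m + 1, ?_⟩
      rwa [Function.iterate_succ_apply, hk, piecewise_eq_of_mem _ _ _ hv]
    · exact houtside v hv

/-- Maximality of a graph is inherited by its restriction to a basin. -/
theorem mul_wt_basin_le {w : Matrix S S ℝ} (hw : ∀ s t, 0 ≤ w s t) {C : Finset S} {η : ℝ}
    {g : S → S} (hg : IsMaximal w C η g) (hpos : 0 < wt w C g) {s : S} {h : S → S}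
    (hh : IsCGraph (basin C g s) h) :
    η * wt w (basin C g s) h ≤ wt w (basin C g s) g := by
  have hmax := hg.2 _ (isCGraph_piecewise_basin hg.1 hh)
  have hg' : wt w C g = (∏ v ∈ C \ basin C g s, w v (g v)) * wt w (basin C g s) g :=
    (Finset.prod_sdiff (basin_subset C g s)).symm
  have hk' : wt w C ((basin C g s).piecewise h g) =
      (∏ v ∈ C \ basin C g s, w v (g v)) * wt w (basin C g s) h := by
    rw [wt, ← Finset.prod_sdiff (basin_subset C g s)]
    congr 1
    · refine Finset.prod_congr rfl fun v hv => ?_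
      rw [piecewise_eq_of_notMem _ _ _ (mem_sdiff.1 hv).2]
    · refine Finset.prod_congr rfl fun v hv => ?_
      rw [piecewise_eq_of_mem _ _ _ hv]
  have hR : 0 ≤ ∏ v ∈ C \ basin C g s, w v (g v) := prod_nonneg fun _ _ => hw _ _
  have hR' : 0 < ∏ v ∈ C \ basin C g s, w v (g v) :=
    hR.lt_of_ne fun h0 => by rw [hg', ← h0, zero_mul] at hpos; exact hpos.false
  rw [hk', hg'] at hmax
  refine le_of_mul_le_mul_left ?_ hR'
  linarith

end Basin

section Flow

theorem exists_isMaximal_one (w : Matrix S S ℝ) {D : Finset S} (hD : D ≠ univ) :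
    ∃ h, IsMaximal w D 1 h := by
  classical
  obtain ⟨r, hr⟩ := exists_notMem_of_ne_univ hD
  obtain ⟨h, hh, hmax⟩ := Finset.exists_max_image (univ.filter fun h => IsCGraph D h) (wt w D)
    ⟨fun _ => r, by simpa using isCGraph_iff.2 fun v => ⟨1, hr⟩⟩
  refine ⟨h, (mem_filter.1 hh).2, fun g' hg' => ?_⟩
  rw [one_mul]
  exact hmax g' (by simpa using hg')

variable {w ρ : Matrix S S ℝ} {z : ℝ} {D : Finset S}

/-- The constant `(|S| - 1) ^ |S|` bounding the number of graphs times the number of states. -/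
def graphBound (S : Type*) [Fintype S] : ℝ :=
  ((Fintype.card S - 1 : ℕ) : ℝ) ^ Fintype.card S

theorem le_mul_edge_of_isMaximal_one (hw : ∀ s t, 0 < w s t)
    (hbal : ∀ s, ∑ t, w s t = ∑ t, w t s) (hz : 0 < z)
    (hcut : ∀ B : Finset S, B.Nonempty → B ≠ univ → z ≤ ∑ s ∈ B, ∑ t ∈ Bᶜ, w s t)
    (hD : D ≠ univ) {h : S → S} (hh : IsMaximal w D 1 h) {v : S} (hv : v ∈ D) :
    z ≤ graphBound S * w v (h v) := by
  have hw' : ∀ s t, 0 ≤ w s t := fun s t => (hw s t).le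
  have hvb := self_mem_basin (g := h) hv
  have hτ : 0 < ∏ u ∈ (basin D h v).erase v, w u (h u) := prod_pos fun _ _ => hw _ _
  have hsplit : wt w (basin D h v) h = w v (h v) * ∏ u ∈ (basin D h v).erase v, w u (h u) :=
    (Finset.mul_prod_erase _ _ hvb).symm
  have key := cut_mul_prod_le hw' hbal hz hcut (basin_ne_univ hD h v) hvb (fun u hu hne => map_mem_basin hu hne)
    (fun u hu => (mem_basin.1 hu).imp fun _ hn => hn.1)
    (P := wt w (basin D h v) h) (prod_nonneg fun _ _ => hw' _ _)
    (fun k hk => by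
      simpa using mul_wt_basin_le hw' hh (prod_pos fun _ _ => hw _ _) hk)
  rw [hsplit, ← mul_assoc] at key
  exact le_of_mul_le_mul_right key hτ

theorem pow_mul_wt_le {c : ℝ} (hw : ∀ s t, 0 < w s t)
    (hbal : ∀ s, ∑ t, w s t = ∑ t, w t s) (hz : 0 < z)
    (hcut : ∀ B : Finset S, B.Nonempty → B ≠ univ → z ≤ ∑ s ∈ B, ∑ t ∈ Bᶜ, w s t)
    (hc : 0 ≤ c) (hcρ : ∀ s t, z ≤ graphBound S * w s t → c * w s t ≤ ρ s t)
    (hD : D ≠ univ) {h : S → S} (hh : IsMaximal w D 1 h) :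
    c ^ D.card * wt w D h ≤ wt ρ D h := by
  rw [wt, wt, ← Finset.prod_const, ← Finset.prod_mul_distrib]
  exact Finset.prod_le_prod (fun v _ => mul_nonneg hc (hw _ _).le) fun v hv =>
    hcρ _ _ (le_mul_edge_of_isMaximal_one hw hbal hz hcut hD hh hv)

theorem wt_pos_of_isMaximal {c β : ℝ} (hw : ∀ s t, 0 < w s t)
    (hbal : ∀ s, ∑ t, w s t = ∑ t, w t s) (hz : 0 < z)
    (hcut : ∀ B : Finset S, B.Nonempty → B ≠ univ → z ≤ ∑ s ∈ B, ∑ t ∈ Bᶜ, w s t)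
    (hc : 0 < c) (hcρ : ∀ s t, z ≤ graphBound S * w s t → c * w s t ≤ ρ s t)
    (hβ : 0 < β) (hD : D ≠ univ) {g : S → S} (hg : IsMaximal ρ D β g) : 0 < wt ρ D g := by
  obtain ⟨h, hh⟩ := exists_isMaximal_one w hD
  have h1 : 0 < c ^ D.card * wt w D h :=
    mul_pos (pow_pos hc _) (prod_pos fun _ _ => hw _ _)
  have h2 := h1.trans_le (pow_mul_wt_le hw hbal hz hcut hc.le hcρ hD hh)
  exact (mul_pos hβ h2).trans_le (hg.2 h hh.1)

/-- Edges of nearly maximal graphs carry a definite amount of flow. -/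
theorem le_edge_of_isMaximal {c K β : ℝ} (hw : ∀ s t, 0 < w s t)
    (hbal : ∀ s, ∑ t, w s t = ∑ t, w t s) (hz : 0 < z)
    (hcut : ∀ B : Finset S, B.Nonempty → B ≠ univ → z ≤ ∑ s ∈ B, ∑ t ∈ Bᶜ, w s t)
    (hρ : ∀ s t, 0 ≤ ρ s t)
    (hc : 0 < c) (hc1 : c ≤ 1) (hcρ : ∀ s t, z ≤ graphBound S * w s t → c * w s t ≤ ρ s t)
    (hK : 1 ≤ K) (hKρ : ∀ s t, ρ s t ≤ K * w s t)
    (hβ : 0 < β) (hD : D ≠ univ) {g : S → S} (hg : IsMaximal ρ D β g) {s : S} (hs : s ∈ D) :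
    β * c ^ Fintype.card S * z ≤ K ^ Fintype.card S * graphBound S * ρ s (g s) := by
  have hw' : ∀ s t, 0 ≤ w s t := fun s t => (hw s t).le
  have hsb := self_mem_basin (g := g) hs
  set E := basin D g s with hE
  have hEne : E ≠ univ := basin_ne_univ hD g s
  obtain ⟨h, hh⟩ := exists_isMaximal_one w hEne
  have hpos : 0 < wt w E h := prod_pos fun _ _ => hw _ _
  have h1 := pow_mul_wt_le hw hbal hz hcut hc.le hcρ hEne hh
  have h2 := mul_wt_basin_le hρ hg (wt_pos_of_isMaximal hw hbal hz hcut hc hcρ hβ hD hg) hh.1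
  have h3 : wt ρ E g = ρ s (g s) * ∏ u ∈ E.erase s, ρ u (g u) :=
    (Finset.mul_prod_erase _ _ hsb).symm
  have h4 : ∏ u ∈ E.erase s, ρ u (g u) ≤ K ^ Fintype.card S * ∏ u ∈ E.erase s, w u (g u) :=
    calc ∏ u ∈ E.erase s, ρ u (g u) ≤ ∏ u ∈ E.erase s, K * w u (g u) :=
          Finset.prod_le_prod (fun _ _ => hρ _ _) fun _ _ => hKρ _ _
      _ = K ^ (E.erase s).card * ∏ u ∈ E.erase s, w u (g u) := by
          rw [Finset.prod_mul_distrib, Finset.prod_const]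
      _ ≤ _ := by
          gcongr
          · exact prod_nonneg fun _ _ => hw' _ _
          · exact Finset.card_le_univ _
  have h5 := cut_mul_prod_le hw' hbal hz hcut hEne hsb (fun u hu hne => map_mem_basin hu hne)
    (fun u hu => (mem_basin.1 hu).imp fun _ hn => hn.1) (P := wt w E h) hpos.le
    (fun k hk => by simpa using hh.2 k hk)
  have h6 : c ^ Fintype.card S ≤ c ^ E.card :=
    pow_le_pow_of_le_one hc.le hc1 (Finset.card_le_univ _)
  have hKpos : 0 ≤ K ^ Fintype.card S := by positivity
  refine le_of_mul_le_mul_right ?_ hpos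
  calc β * c ^ Fintype.card S * z * wt w E h
      ≤ β * c ^ E.card * z * wt w E h := by gcongr
    _ = z * (β * (c ^ E.card * wt w E h)) := by ring
    _ ≤ z * (β * wt ρ E h) := by gcongr
    _ ≤ z * wt ρ E g := by gcongr
    _ ≤ z * (ρ s (g s) * (K ^ Fintype.card S * ∏ u ∈ E.erase s, w u (g u))) := by
        rw [h3]
        have := hρ s (g s)
        gcongr
    _ = ρ s (g s) * K ^ Fintype.card S * (z * ∏ u ∈ E.erase s, w u (g u)) := by ring
    _ ≤ ρ s (g s) * K ^ Fintype.card S * (graphBound S * wt w E h) :=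
        mul_le_mul_of_nonneg_left h5 (mul_nonneg (hρ _ _) hKpos)
    _ = _ := by ring

end Flow

section Chain

variable {q : Matrix S S ℝ} {μ : S → ℝ}

theorem exists_transition_pos (hirr : IsIrreducible q) (hq : IsTransition q) {B : Finset S}
    (hB : B.Nonempty) (hB' : B ≠ univ) : ∃ s ∈ B, ∃ t ∉ B, 0 < q s t := by
  by_contra! hno
  obtain ⟨a, ha⟩ := hB
  obtain ⟨b, hb⟩ := exists_notMem_of_ne_univ hB'
  have hzero : ∀ n : ℕ, ∀ s ∈ B, ∀ t ∉ B, (q ^ n) s t = 0 := by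
    intro n
    induction n with
    | zero =>
      intro s hs t ht
      rw [pow_zero, Matrix.one_apply_ne]
      rintro rfl
      exact ht hs
    | succ n ih =>
      intro s hs t ht
      rw [pow_succ, Matrix.mul_apply]
      refine Finset.sum_eq_zero fun u _ => ?_
      by_cases hu : u ∈ B
      · rw [le_antisymm (hno u hu t ht) (hq.1 u t), mul_zero]
      · rw [ih s hs u hu, zero_mul]
  obtain ⟨n, -, hn⟩ := hirr a b
  exact hn.ne' (hzero n a ha b hb)

theorem stationary_pos (hirr : IsIrreducible q) (hq : IsTransition q) (hμ : IsStationary q μ)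
    (s : S) : 0 < μ s := by
  by_contra hs
  have hne : (univ.filter fun v => 0 < μ v) ≠ univ := fun h =>
    hs (mem_filter.1 (h ▸ mem_univ s : s ∈ univ.filter _)).2
  have hnonempty : (univ.filter fun v => 0 < μ v).Nonempty := by
    obtain ⟨v, -, hv⟩ := Finset.exists_lt_of_sum_lt (s := univ) (f := fun _ => (0 : ℝ)) (g := μ)
      (by simp [hμ.2.1])
    exact ⟨v, by simpa using hv⟩
  obtain ⟨u, hu, t, ht, hut⟩ := exists_transition_pos hirr hq hnonempty hne
  simp only [mem_filter, mem_univ, true_and] at hu ht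
  refine ht ?_
  rw [← hμ.2.2 t]
  exact (mul_pos hu hut).trans_le (single_le_sum (f := fun v => μ v * q v t)
    (fun v _ => mul_nonneg (hμ.1 v) (hq.1 v t)) (mem_univ u))

theorem cutFlow_pos (hirr : IsIrreducible q) (hq : IsTransition q) (hμ : IsStationary q μ)
    {B : Finset S} (hB : B.Nonempty) (hB' : B ≠ univ) :
    0 < ∑ s ∈ B, μ s * ∑ t ∈ Bᶜ, q s t := by
  obtain ⟨s, hs, t, ht, hst⟩ := exists_transition_pos hirr hq hB hB'
  have h1 : 0 < ∑ t ∈ Bᶜ, q s t :=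
    Finset.sum_pos' (fun t _ => hq.1 s t) ⟨t, mem_compl.2 ht, hst⟩
  exact Finset.sum_pos' (fun s _ => mul_nonneg (hμ.1 s) (sum_nonneg fun t _ => hq.1 s t))
    ⟨s, hs, mul_pos (stationary_pos hirr hq hμ s) h1⟩

theorem zeta_le (hq : IsTransition q) (hμ : IsStationary q μ) {B : Finset S} (hB : B.Nonempty)
    (hB' : B ≠ univ) : zeta q μ ≤ ∑ s ∈ B, μ s * ∑ t ∈ Bᶜ, q s t := by
  refine csInf_le ⟨0, ?_⟩ ⟨B, hB, hB', rfl⟩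
  rintro x ⟨D, -, -, rfl⟩
  exact sum_nonneg fun s _ => mul_nonneg (hμ.1 s) (sum_nonneg fun t _ => hq.1 s t)

theorem zeta_pos (hirr : IsIrreducible q) (hq : IsTransition q) (hμ : IsStationary q μ)
    {B : Finset S} (hB : B.Nonempty) (hB' : B ≠ univ) : 0 < zeta q μ := by
  have hfin : {x : ℝ | ∃ C : Finset S, C.Nonempty ∧ C ≠ Finset.univ ∧
      x = ∑ s ∈ C, μ s * ∑ t ∈ Cᶜ, q s t}.Finite := by
    refine (Set.finite_range fun C : Finset S => ∑ s ∈ C, μ s * ∑ t ∈ Cᶜ, q s t).subset ?_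
    rintro x ⟨D, -, -, rfl⟩
    exact ⟨D, rfl⟩
  have hne : {x : ℝ | ∃ C : Finset S, C.Nonempty ∧ C ≠ Finset.univ ∧
      x = ∑ s ∈ C, μ s * ∑ t ∈ Cᶜ, q s t}.Nonempty := ⟨_, B, hB, hB', rfl⟩
  obtain ⟨D, hD, hD', h⟩ := hne.csInf_mem hfin
  rw [zeta, h]
  exact cutFlow_pos hirr hq hμ hD hD'

variable {p : Matrix S S ℝ} {β ε : ℝ} {C : Finset S}

omit [Fintype S] [DecidableEq S] in
theorem wt_of_mul (μ : S → ℝ) (p : Matrix S S ℝ) (C : Finset S) (g : S → S) :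
    wt (Matrix.of fun s t => μ s * p s t) C g = (∏ s ∈ C, μ s) * wt p C g := by
  simp [wt, Finset.prod_mul_distrib]

/-- A nearly maximal graph of a chain close to `q` has positive weight and only uses edges carrying
flow at least `ε * ζ_q`. -/
theorem IsMaximal.le_flow (hirr : IsIrreducible q) (hq : IsTransition q) (hμ : IsStationary q μ)
    (hp : IsTransition p) (hβ0 : 0 < β) (hβN : Fintype.card S * β ≤ 1 / 2) (hβ1 : β < 1)
    (hε0 : 0 < ε) (hM : 1 ≤ graphBound S) (hεM : 32 * (ε * graphBound S) ≤ β)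
    (hclose : IsClose q p μ (zeta q μ) ε β) (hC : C.Nonempty) (hC' : C ≠ univ)
    {g : S → S} (hg : IsMaximal p C β g) :
    0 < wt p C g ∧ ∀ s ∈ C, ε * zeta q μ ≤ μ s * p s (g s) := by
  have hz := zeta_pos hirr hq hμ hC hC'
  set z := zeta q μ with hzdef
  set M := graphBound S with hMdef
  set w : Matrix S S ℝ := Matrix.of fun s t => μ s * q s t + ε * z with hwdef
  set ρ : Matrix S S ℝ := Matrix.of fun s t => μ s * p s t with hρdef
  have hμpos := stationary_pos hirr hq hμ
  have hφ : ∀ s t, 0 ≤ μ s * q s t := fun s t => mul_nonneg (hμ.1 s) (hq.1 s t)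
  have hεz : 0 < ε * z := mul_pos hε0 hz
  have hw : ∀ s t, 0 < w s t := fun s t => add_pos_of_nonneg_of_pos (hφ s t) hεz
  have hρ : ∀ s t, 0 ≤ ρ s t := fun s t => mul_nonneg (hμ.1 s) (hp.1 s t)
  have hbal : ∀ s, ∑ t, w s t = ∑ t, w t s := by
    intro s
    simp only [hwdef, Matrix.of_apply, Finset.sum_add_distrib, hμ.2.2, ← Finset.mul_sum, hq.2,
      mul_one]
  have hcut : ∀ B : Finset S, B.Nonempty → B ≠ univ → z ≤ ∑ s ∈ B, ∑ t ∈ Bᶜ, w s t := by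
    intro B hB hB'
    refine (zeta_le hq hμ hB hB').trans (Finset.sum_le_sum fun s _ => ?_)
    rw [Finset.mul_sum]
    exact Finset.sum_le_sum fun t _ => le_add_of_nonneg_right hεz.le
  set c := (1 - β) * (1 - ε * M) with hcdef
  have hεM0 : 0 < ε * M := mul_pos hε0 (by linarith)
  have hc0 : 0 < c := mul_pos (by linarith) (by linarith)
  have hc1 : c ≤ 1 := mul_le_one₀ (by linarith) (by linarith) (by linarith)
  have hcρ : ∀ s t, z ≤ M * w s t → c * w s t ≤ ρ s t := by
    intro s t hst
    have h1 : (1 - ε * M) * w s t ≤ μ s * q s t := by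
      have h2 : w s t = μ s * q s t + ε * z := rfl
      nlinarith
    have h3 : ε * z ≤ μ s * q s t := by
      have h4 : ε * z ≤ ε * M * w s t := by nlinarith
      have h5 : ε * M * w s t ≤ (1 - ε * M) * w s t :=
        mul_le_mul_of_nonneg_right (by linarith) (hw s t).le
      linarith
    have h6 := (abs_le.1 (hclose s t (Or.inl h3))).1
    have h7 : μ s * ((1 - β) * q s t) ≤ μ s * p s t :=
      mul_le_mul_of_nonneg_left (by linarith) (hμ.1 s)
    calc c * w s t = (1 - β) * ((1 - ε * M) * w s t) := by rw [hcdef, mul_assoc]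
      _ ≤ (1 - β) * (μ s * q s t) := mul_le_mul_of_nonneg_left h1 (by linarith)
      _ = μ s * ((1 - β) * q s t) := by ring
      _ ≤ ρ s t := h7
  have hKρ : ∀ s t, ρ s t ≤ (1 + β) * w s t := by
    intro s t
    have hwst : w s t = μ s * q s t + ε * z := rfl
    have hρst : ρ s t = μ s * p s t := rfl
    by_cases h : ε * z ≤ μ s * p s t
    · have h6 := (abs_le.1 (hclose s t (Or.inr h))).2
      have h7 : μ s * p s t ≤ μ s * ((1 + β) * q s t) :=
        mul_le_mul_of_nonneg_left (by linarith) (hμ.1 s)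
      rw [hwst, hρst]
      nlinarith
    · have := hφ s t
      have := hw s t
      rw [hρst]
      nlinarith
  have hgρ : IsMaximal ρ C β g := by
    refine ⟨hg.1, fun g' hg' => ?_⟩
    rw [hρdef, wt_of_mul, wt_of_mul, mul_left_comm]
    exact mul_le_mul_of_nonneg_left (hg.2 g' hg') (prod_nonneg fun s _ => hμ.1 s)
  refine ⟨?_, fun s hs => ?_⟩
  · have h1 := wt_pos_of_isMaximal hw hbal hz hcut hc0 hcρ hβ0 hC' hgρ
    rw [hρdef, wt_of_mul] at h1
    exact pos_of_mul_pos_right h1 (prod_nonneg fun s _ => hμ.1 s)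
  · have key := le_edge_of_isMaximal hw hbal hz hcut hρ hc0 hc1 hcρ (by linarith : 1 ≤ 1 + β) hKρ
      hβ0 hC' hgρ hs
    have hpow : ∀ x, 0 ≤ x → x ≤ β → 1 / 2 ≤ (1 - x) ^ Fintype.card S := by
      intro x hx0 hx
      have := one_add_mul_le_pow (a := -x) (by linarith) (Fintype.card S)
      have : (Fintype.card S : ℝ) * x ≤ Fintype.card S * β := by gcongr
      rw [sub_eq_add_neg]
      linarith
    have h1 := hpow β hβ0.le le_rfl
    have h2 := hpow (ε * M) hεM0.le (by linarith)
    have h3 : (1 : ℝ) / 4 ≤ c ^ Fintype.card S := by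
      rw [hcdef, mul_pow]
      nlinarith
    have h4 : (1 + β) ^ Fintype.card S ≤ 2 := by
      have h5 : (1 + β) ^ Fintype.card S * (1 - β) ^ Fintype.card S ≤ 1 := by
        rw [← mul_pow]
        exact pow_le_one₀ (by nlinarith) (by nlinarith)
      have h6 : 0 ≤ (1 + β) ^ Fintype.card S := by positivity
      nlinarith
    have hρs := hρ s (g s)
    have h7 : β * (1 / 4) * z ≤ 2 * M * ρ s (g s) :=
      calc β * (1 / 4) * z ≤ β * c ^ Fintype.card S * z := by gcongr
        _ ≤ _ := key
        _ ≤ _ := by gcongr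
    have h8 : M * (ε * z) ≤ M * ρ s (g s) := by nlinarith
    exact le_of_mul_le_mul_left h8 (by linarith)

end Chain

theorem one_add_pow_le {β : ℝ} (hβ : 0 ≤ β) {n : ℕ} (h : 2 ^ n * β ≤ 1) :
    (1 + β) ^ n ≤ 1 + n * β + 2 ^ n * β ^ 2 := by
  induction n with
  | zero => simp [sq_nonneg]
  | succ n ih =>
    have h2 : 2 ^ n * β ≤ 1 := by
      refine le_trans ?_ h
      gcongr <;> norm_num
    have hn : ((n : ℝ) + 1) ≤ 2 ^ n := by exact_mod_cast Nat.lt_two_pow_self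
    have := ih h2
    rw [pow_succ (1 + β), pow_succ 2]
    push_cast
    calc (1 + β) ^ n * (1 + β) ≤ (1 + n * β + 2 ^ n * β ^ 2) * (1 + β) := by gcongr
      _ = 1 + (n + 1) * β + (n + 2 ^ n + 2 ^ n * β) * β ^ 2 := by ring
      _ ≤ 1 + (n + 1) * β + (2 ^ n * 2) * β ^ 2 := by
          gcongr
          linarith

omit [Fintype S] [DecidableEq S] in
/-- Graph weights under two chains differ by a small factor if all the edges do. -/
theorem abs_wt_sub_le {q p : Matrix S S ℝ} {β : ℝ} {C : Finset S} {g : S → S}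
    (hq : ∀ s t, 0 ≤ q s t) (hβ0 : 0 ≤ β) (hβ1 : β ≤ 1) (hβC : 2 ^ C.card * β ≤ 1)
    (hedge : ∀ s ∈ C, |p s (g s) - q s (g s)| ≤ β * q s (g s)) :
    |wt p C g - wt q C g| ≤ (C.card + 1) * β * wt q C g := by
  have hW : 0 ≤ wt q C g := prod_nonneg fun _ _ => hq _ _
  have hlow : (1 - β) ^ C.card * wt q C g ≤ wt p C g := by
    rw [wt, wt, ← Finset.prod_const, ← Finset.prod_mul_distrib]
    exact Finset.prod_le_prod (fun s _ => mul_nonneg (by linarith) (hq _ _)) fun s hs => by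
      linarith [(abs_le.1 (hedge s hs)).1]
  have hup : wt p C g ≤ (1 + β) ^ C.card * wt q C g := by
    rw [wt, wt, ← Finset.prod_const, ← Finset.prod_mul_distrib]
    refine Finset.prod_le_prod (fun s hs => ?_) fun s hs => by
      linarith [(abs_le.1 (hedge s hs)).2]
    have := mul_nonneg (sub_nonneg.2 hβ1) (hq s (g s))
    linarith [(abs_le.1 (hedge s hs)).1]
  have h1 := one_add_mul_le_pow (a := -β) (by linarith) C.card
  have h2 := one_add_pow_le hβ0 hβC
  have h3 : (1 + β) ^ C.card ≤ 1 + (C.card + 1) * β := by nlinarith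
  have h4 : 1 - (C.card + 1) * β ≤ (1 - β) ^ C.card := by
    rw [sub_eq_add_neg 1 β]
    linarith
  rw [abs_le]
  constructor <;> nlinarith

omit [DecidableEq S] in
theorem card_mul_graphBound_le (hcard : 2 ≤ Fintype.card S) :
    Fintype.card S * graphBound S ≤ Lconst S := by
  have h : Fintype.card S * (Fintype.card S - 1) ^ Fintype.card S ≤ Lconst S := by
    have hc : (Fintype.card S).choose (Fintype.card S - 1) = Fintype.card S := by
      rw [← Nat.choose_symm (by omega), Nat.sub_sub_self (by omega), Nat.choose_one_right]
    have := single_le_sum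
      (f := fun n => (Fintype.card S).choose n * n ^ Fintype.card S)
      (s := Finset.Ico 1 (Fintype.card S)) (a := Fintype.card S - 1)
      (fun _ _ => Nat.zero_le _) (by simp; omega)
    simpa only [hc, Lconst] using this
  rw [graphBound]
  exact_mod_cast h

theorem mem_Hset {q p : Matrix S S ℝ} {β : ℝ} {C : Finset S} {g : S → S} :
    g ∈ Hset q p C β ↔
      IsCGraph C g ∧ (∀ s ∉ C, g s = s) ∧ (IsMaximal q C β g ∨ IsMaximal p C β g) := by
  simp [Hset, Gset, and_assoc]

/-- Corollary `propcore`: for `g ∈ G^β(C) ∪ Ĝ^β(C)`,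
`|1 − p̂(g)/p(g)| ≤ (|S|+1)β`, and with `H = G^β(C) ∪ Ĝ^β(C)`,
`|(Σ_H p̂(g))/(Σ_H p(g)) − 1| < (|S|+1)β`. -/
theorem maximal_graph_weights_close
    (hcard : 2 ≤ Fintype.card S)
    (q qh : Matrix S S ℝ) (μ : S → ℝ) (β ε : ℝ)
    (hβ0 : 0 < β) (hβ1 : β < 1 / 2 ^ Fintype.card S)
    (hε0 : 0 < ε)
    (hε1 : ε < β * (1 - β) / ((Lconst S : ℝ) * (Fintype.card S : ℝ) ^ 4))
    (hq : IsTransition q) (hqirr : IsIrreducible q) (hμ : IsStationary q μ)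
    (hqh : IsTransition qh)
    (hclose : IsClose q qh μ (zeta q μ) ε β)
    (C : Finset S) (hCne : C.Nonempty) (hCproper : C ≠ Finset.univ) :
    (∀ g : S → S, IsMaximal q C β g ∨ IsMaximal qh C β g →
        |1 - wt qh C g / wt q C g| ≤ ((Fintype.card S : ℝ) + 1) * β) ∧
      |(∑ g ∈ Hset q qh C β, wt qh C g) / (∑ g ∈ Hset q qh C β, wt q C g) - 1| <
        ((Fintype.card S : ℝ) + 1) * β := by
  classical
  set N : ℝ := (Fintype.card S : ℝ) with hN
  have hN2 : (2 : ℝ) ≤ N := by rw [hN]; exact_mod_cast hcard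
  have hM : 1 ≤ graphBound S := by
    rw [graphBound]
    exact one_le_pow₀ (by exact_mod_cast (by omega : 1 ≤ Fintype.card S - 1))
  have h2N : 2 ^ Fintype.card S * β < 1 := by
    rwa [lt_div_iff₀ (by positivity), mul_comm] at hβ1
  have hNβ : N * β ≤ 1 / 2 := by
    have h : 2 * N ≤ 2 ^ Fintype.card S := by
      have : 2 * Fintype.card S ≤ 2 ^ Fintype.card S := by
        obtain ⟨n, hn⟩ : ∃ n, Fintype.card S = n + 1 := ⟨Fintype.card S - 1, by omega⟩
        have := Nat.lt_two_pow_self (n := n)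
        rw [hn, pow_succ]
        omega
      rw [hN]
      exact_mod_cast this
    nlinarith
  have hβlt : β < 1 := by nlinarith
  have hL : N * graphBound S ≤ Lconst S := card_mul_graphBound_le hcard
  have hεM : 32 * (ε * graphBound S) ≤ β := by
    have hLpos : (0 : ℝ) < Lconst S := by nlinarith
    rw [lt_div_iff₀ (by positivity)] at hε1
    have hN5 : (32 : ℝ) ≤ N ^ 5 :=
      calc (32 : ℝ) = 2 ^ 5 := by norm_num
        _ ≤ N ^ 5 := by gcongr
    calc 32 * (ε * graphBound S) ≤ N ^ 5 * (ε * graphBound S) := by gcongr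
      _ = ε * (N * graphBound S * N ^ 4) := by ring
      _ ≤ ε * (Lconst S * N ^ 4) := by gcongr
      _ ≤ β * (1 - β) := hε1.le
      _ ≤ β := by nlinarith
  have hclose' : IsClose q q μ (zeta q μ) ε β := fun s t _ => by
    simpa using mul_nonneg hβ0.le (hq.1 s t)
  have hedge : ∀ g, IsMaximal q C β g ∨ IsMaximal qh C β g →
      ∀ s ∈ C, |qh s (g s) - q s (g s)| ≤ β * q s (g s) := by
    rintro g (hg | hg) s hs
    · exact hclose _ _ (Or.inl ((hg.le_flow hqirr hq hμ hq hβ0 hNβ hβlt hε0 hM hεM hclose'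
        hCne hCproper).2 s hs))
    · exact hclose _ _ (Or.inr ((hg.le_flow hqirr hq hμ hqh hβ0 hNβ hβlt hε0 hM hεM hclose
        hCne hCproper).2 s hs))
  have hpos : ∀ g, IsMaximal q C β g ∨ IsMaximal qh C β g → 0 < wt q C g := by
    rintro g (hg | hg)
    · exact (hg.le_flow hqirr hq hμ hq hβ0 hNβ hβlt hε0 hM hεM hclose' hCne hCproper).1
    · have h1 := (hg.le_flow hqirr hq hμ hqh hβ0 hNβ hβlt hε0 hM hεM hclose hCne hCproper).1
      refine prod_pos fun s hs => (hq.1 _ _).lt_of_ne fun h0 => h1.ne' ?_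
      have h2 := hedge g (Or.inr hg) s hs
      rw [← h0, mul_zero, sub_zero] at h2
      exact prod_eq_zero hs (abs_nonpos_iff.1 h2)
  have hCN : C.card + 1 ≤ Fintype.card S := by
    obtain ⟨r, hr⟩ := exists_notMem_of_ne_univ hCproper
    exact card_lt_univ_of_notMem hr
  have hdiff : ∀ g, IsMaximal q C β g ∨ IsMaximal qh C β g →
      |wt qh C g - wt q C g| ≤ N * β * wt q C g := by
    intro g hg
    have hCβ : 2 ^ C.card * β ≤ 1 := by
      refine le_trans ?_ h2N.le
      gcongr
      · norm_num
      · omega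
    refine (abs_wt_sub_le hq.1 hβ0.le hβlt.le hCβ (hedge g hg)).trans ?_
    have := (hpos g hg).le
    gcongr
    rw [hN]
    exact_mod_cast hCN
  constructor
  · intro g hg
    have hg0 := hpos g hg
    have h1 : 1 - wt qh C g / wt q C g = -((wt qh C g - wt q C g) / wt q C g) := by
      field_simp
      ring
    rw [h1, abs_neg, abs_div, abs_of_pos hg0, div_le_iff₀ hg0]
    refine (hdiff g hg).trans ?_
    gcongr
    linarith
  · have hmem : ∀ g ∈ Hset q qh C β, IsMaximal q C β g ∨ IsMaximal qh C β g :=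
      fun g hg => (mem_Hset.1 hg).2.2
    have hne : (Hset q qh C β).Nonempty := by
      obtain ⟨h, hh⟩ := exists_isMaximal_one q hCproper
      have hout : ∀ s, s ∉ C → C.piecewise h id s = s := fun s hs =>
        piecewise_eq_of_notMem _ _ _ hs
      have hwt : wt q C (C.piecewise h id) = wt q C h :=
        prod_congr rfl fun s hs => by rw [piecewise_eq_of_mem _ _ _ hs]
      have hgraph : IsCGraph C (C.piecewise h id) := by
        rintro ⟨k, f, hk, hcyc, hfC, hstep⟩
        refine hh.1 ⟨k, f, hk, hcyc, hfC, fun i hi => ?_⟩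
        rw [← hstep i hi, piecewise_eq_of_mem _ _ _ (hfC i hi)]
      refine ⟨C.piecewise h id, mem_Hset.2 ⟨hgraph, hout,
        Or.inl ⟨hgraph, fun g' hg' => ?_⟩⟩⟩
      rw [hwt]
      refine le_trans ?_ (hh.2 g' hg')
      have : 0 ≤ wt q C g' := prod_nonneg fun _ _ => hq.1 _ _
      gcongr
    have hsum : 0 < ∑ g ∈ Hset q qh C β, wt q C g :=
      sum_pos (fun g hg => hpos g (hmem g hg)) hne
    rw [div_sub_one hsum.ne', abs_div, abs_of_pos hsum, div_lt_iff₀ hsum, ← sum_sub_distrib]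
    calc |∑ g ∈ Hset q qh C β, (wt qh C g - wt q C g)|
        ≤ ∑ g ∈ Hset q qh C β, |wt qh C g - wt q C g| := abs_sum_le_sum_abs _ _
      _ ≤ ∑ g ∈ Hset q qh C β, N * β * wt q C g :=
          sum_le_sum fun g hg => hdiff g (hmem g hg)
      _ = N * β * ∑ g ∈ Hset q qh C β, wt q C g := by rw [mul_sum]
      _ < (N + 1) * β * ∑ g ∈ Hset q qh C β, wt q C g := by
          gcongr
          linarith

end PerturbedMC
end

section
/- Let q be an irreducible transition matrix on S, C a nonempty proper subset of S, s ∈ C and t ∉ C. Then the exit distribution satisfies Q_{s,q}(t|C) = (Σ_{g∈G_{s,t}(C)} p(g)) / (Σ_{g∈G(C)} p(g)). -/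
open Finset

namespace PerturbedMC

variable {S : Type*} [Fintype S] [DecidableEq S]

open scoped Matrix

lemma mem_Gset {C : Finset S} {g : S → S} :
    g ∈ Gset C ↔ IsCGraph C g ∧ ∀ s ∉ C, g s = s := by
  simp [Gset]

lemma mem_GsetLead {C : Finset S} {g : S → S} {s t : S} :
    g ∈ GsetLead C s t ↔ g ∈ Gset C ∧ LeadsTo C g s t := by
  simp [GsetLead]

omit [Fintype S] [DecidableEq S] in
/-- Once the orbit of a map fixing the complement of `C` leaves `C`, it stays put. -/
lemma iterate_eq_of_notMem {C : Finset S} {g : S → S} (hfix : ∀ s ∉ C, g s = s) {u : S}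
    {m n : ℕ} (hmn : m ≤ n) (hm : g^[m] u ∉ C) : g^[n] u = g^[m] u := by
  obtain ⟨k, rfl⟩ := Nat.exists_eq_add_of_le' hmn
  rw [Function.iterate_add_apply]
  exact Function.iterate_fixed (hfix _ hm) k

omit [Fintype S] in
lemma leadsTo_iff {C : Finset S} {g : S → S} (hfix : ∀ s ∉ C, g s = s) {u t : S}
    (ht : t ∉ C) : LeadsTo C g u t ↔ ∃ n, g^[n] u = t := by
  classical
  refine ⟨fun ⟨n, h, _⟩ => ⟨n, h⟩, fun ⟨n, hn⟩ => ?_⟩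
  have hex : ∃ m, g^[m] u ∉ C := ⟨n, hn ▸ ht⟩
  refine ⟨Nat.find hex, ?_, ht, fun m hm => not_not.1 (Nat.find_min hex hm)⟩
  rw [← hn]
  exact (iterate_eq_of_notMem hfix (Nat.find_min' hex (hn ▸ ht)) (Nat.find_spec hex)).symm

omit [Fintype S] [DecidableEq S] in
lemma isCGraph_of_forall_exits {C : Finset S} {g : S → S}
    (h : ∀ u, ∃ n, g^[n] u ∉ C) : IsCGraph C g := by
  rintro ⟨k, f, hk, hcyc, hC, hg⟩
  have key : ∀ n, ∃ i < k, g^[n] (f 0) = f i := by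
    intro n
    induction n with
    | zero => exact ⟨0, hk, rfl⟩
    | succ n ih =>
      obtain ⟨i, hi, h⟩ := ih
      rw [Function.iterate_succ_apply', h, hg i hi]
      rcases (Nat.succ_le_of_lt hi).lt_or_eq with h' | h'
      · exact ⟨i + 1, h', rfl⟩
      · exact ⟨0, hk, by rw [← hcyc, ← h']⟩
  obtain ⟨n, hn⟩ := h (f 0)
  obtain ⟨i, hi, h⟩ := key n
  exact hn (h ▸ hC i hi)

omit [DecidableEq S] in
lemma IsCGraph.exits {C : Finset S} {g : S → S} (hg : IsCGraph C g) (u : S) :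
    ∃ n, g^[n] u ∉ C := by
  by_contra! hcon
  obtain ⟨m, n, hmn, heq⟩ := Finite.exists_ne_map_eq_of_infinite (fun n : ℕ => g^[n] u)
  wlog hlt : m < n generalizing m n
  · exact this n m hmn.symm heq.symm (by omega)
  refine hg ⟨n - m, fun i => g^[m + i] u, by omega, ?_, fun i _ => hcon _, fun i _ => ?_⟩
  · simpa [Nat.add_sub_cancel' hlt.le] using heq.symm
  · exact (Function.iterate_succ_apply' g (m + i) u).symm

lemma iterate_succ_ne {C : Finset S} {g : S → S} (hg : g ∈ Gset C) {s : S} (hs : s ∈ C)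
    (n : ℕ) : g^[n] (g s) ≠ s := by
  intro h
  obtain ⟨hac, hfix⟩ := mem_Gset.1 hg
  have hper : g^[n + 1] s = s := h
  obtain ⟨m, hm⟩ := hac.exits s
  have h1 : g^[(n + 1) * m] s = s := by
    rw [Function.iterate_mul]
    exact Function.iterate_fixed hper m
  rw [iterate_eq_of_notMem hfix (Nat.le_mul_of_pos_left m n.succ_pos) hm] at h1
  rw [h1] at hm
  exact hm hs

omit [Fintype S] in
lemma iterate_update_of_forall_ne {g : S → S} {s v : S} (h : ∀ n, g^[n] v ≠ s) (w : S) (n : ℕ) :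
    (Function.update g s w)^[n] v = g^[n] v := by
  induction n with
  | zero => rfl
  | succ n ih =>
    rw [Function.iterate_succ_apply', Function.iterate_succ_apply', ih,
      Function.update_of_ne (h n)]

lemma update_mem_Gset {C : Finset S} {g : S → S} (hg : g ∈ Gset C) {s v : S} (hs : s ∈ C)
    (hv : ∀ n, g^[n] v ≠ s) : Function.update g s v ∈ Gset C := by
  obtain ⟨hac, hfix⟩ := mem_Gset.1 hg
  refine mem_Gset.2 ⟨isCGraph_of_forall_exits fun u => ?_, fun x hx => ?_⟩
  · by_cases hu : ∃ n, (Function.update g s v)^[n] u = s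
    · obtain ⟨n, hn⟩ := hu
      obtain ⟨m, hm⟩ := hac.exits v
      refine ⟨m + (n + 1), ?_⟩
      rwa [Function.iterate_add_apply, Function.iterate_succ_apply', hn, Function.update_self,
        iterate_update_of_forall_ne hv]
    · push Not at hu
      obtain ⟨n, hn⟩ := hac.exits u
      refine ⟨n, ?_⟩
      rw [← iterate_update_of_forall_ne hu (g s) n]
      simpa using hn
  · rw [Function.update_of_ne (by rintro rfl; exact hx hs), hfix x hx]

omit [Fintype S] in
lemma mul_wt_update (q : Matrix S S ℝ) {C : Finset S} (g : S → S) {s : S} (hs : s ∈ C) (v : S) :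
    q s (g s) * wt q C (Function.update g s v) = q s v * wt q C g := by
  unfold wt
  rw [← mul_prod_erase C _ hs, ← mul_prod_erase C (fun x => q x (g x)) hs, Function.update_self]
  have : ∏ x ∈ C.erase s, q x (Function.update g s v x) = ∏ x ∈ C.erase s, q x (g x) :=
    prod_congr rfl fun x hx => by rw [Function.update_of_ne (ne_of_mem_erase hx)]
  rw [this]
  ring

omit [Fintype S] [DecidableEq S] in
lemma exists_iterate_iff_of_passes {C : Finset S} {g : S → S} (hfix : ∀ s ∉ C, g s = s)
    {s t v : S} (hs : s ∈ C) (ht : t ∉ C) (hv : ∃ n, g^[n] v = s) :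
    (∃ n, g^[n] v = t) ↔ ∃ n, g^[n] s = t := by
  obtain ⟨n, rfl⟩ := hv
  constructor
  · rintro ⟨m, rfl⟩
    have hnm : n ≤ m := by
      by_contra! hlt
      exact ht (iterate_eq_of_notMem hfix hlt.le ht ▸ hs)
    exact ⟨m - n, by rw [← Function.iterate_add_apply, Nat.sub_add_cancel hnm]⟩
  · rintro ⟨m, rfl⟩
    exact ⟨m + n, Function.iterate_add_apply ..⟩

open Classical in
/-- The involution exchanging the edge of `g` at `s` with a proposed edge to `v`, whenever the
exchange creates no cycle. -/
noncomputable def swapEdge (s : S) (x : Σ _ : S, S → S) : Σ _ : S, S → S :=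
  if ∃ n, x.2^[n] x.1 = s then x else ⟨x.2 s, Function.update x.2 s x.1⟩

lemma swapEdge_swapEdge {C : Finset S} {s : S} (hs : s ∈ C) {x : Σ _ : S, S → S}
    (hx : x.2 ∈ Gset C) : swapEdge s (swapEdge s x) = x := by
  obtain ⟨v, g⟩ := x
  by_cases h : ∃ n, g^[n] v = s
  · simp [swapEdge, h]
  · have hn : ¬ ∃ n, (Function.update g s v)^[n] (g s) = s := by
      rintro ⟨n, hn⟩
      rw [iterate_update_of_forall_ne (iterate_succ_ne hx hs)] at hn
      exact iterate_succ_ne hx hs n hn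
    simp [swapEdge, h, hn]

lemma swapEdge_snd_mem_Gset {C : Finset S} {s : S} (hs : s ∈ C) {x : Σ _ : S, S → S}
    (hx : x.2 ∈ Gset C) : (swapEdge s x).2 ∈ Gset C := by
  unfold swapEdge
  split_ifs with h
  · exact hx
  · push Not at h
    exact update_mem_Gset hx hs h

lemma leadsTo_swapEdge_iff {C : Finset S} {s t : S} (hs : s ∈ C) (ht : t ∉ C)
    {x : Σ _ : S, S → S} (hx : x.2 ∈ Gset C) :
    LeadsTo C (swapEdge s x).2 (swapEdge s x).1 t ↔ LeadsTo C x.2 s t := by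
  have hfix := (mem_Gset.1 hx).2
  rw [leadsTo_iff (mem_Gset.1 (swapEdge_snd_mem_Gset hs hx)).2 ht, leadsTo_iff hfix ht]
  unfold swapEdge
  split_ifs with h
  · exact exists_iterate_iff_of_passes hfix hs ht h
  · simp only [iterate_update_of_forall_ne (iterate_succ_ne hx hs)]
    refine ⟨fun ⟨n, hn⟩ => ⟨n + 1, hn⟩, fun ⟨n, hn⟩ => ?_⟩
    cases n with
    | zero => exact absurd (hn ▸ hs) ht
    | succ n => exact ⟨n, hn⟩

omit [Fintype S] in
lemma mul_wt_swapEdge (q : Matrix S S ℝ) {C : Finset S} {s : S} (hs : s ∈ C)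
    (x : Σ _ : S, S → S) :
    q s (swapEdge s x).1 * wt q C (swapEdge s x).2 = q s x.1 * wt q C x.2 := by
  unfold swapEdge
  split_ifs
  · rfl
  · exact mul_wt_update q x.2 hs x.1

/-- The weights of the `C`-graphs leading to `t` form a harmonic function on `C`. -/
lemma sum_mul_sum_GsetLead {q : Matrix S S ℝ} (hq : IsTransition q) {C : Finset S} {s t : S}
    (hs : s ∈ C) (ht : t ∉ C) :
    ∑ v, q s v * ∑ g ∈ GsetLead C v t, wt q C g = ∑ g ∈ GsetLead C s t, wt q C g := by
  conv_rhs => rw [← one_mul (∑ g ∈ _, _), ← hq.2 s, sum_mul]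
  simp only [mul_sum]
  rw [sum_sigma', sum_sigma']
  symm
  refine sum_nbij' (swapEdge s) (swapEdge s) ?_ ?_ ?_ ?_ ?_
  · intro x hx
    simp only [mem_sigma, mem_univ, true_and, mem_GsetLead] at hx ⊢
    exact ⟨swapEdge_snd_mem_Gset hs hx.1, (leadsTo_swapEdge_iff hs ht hx.1).2 hx.2⟩
  · intro x hx
    simp only [mem_sigma, mem_univ, true_and, mem_GsetLead] at hx ⊢
    have hmem := swapEdge_snd_mem_Gset hs hx.1
    refine ⟨hmem, (leadsTo_swapEdge_iff hs ht hmem).1 ?_⟩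
    rw [swapEdge_swapEdge hs hx.1]
    exact hx.2
  · intro x hx
    simp only [mem_sigma, mem_univ, true_and, mem_GsetLead] at hx
    exact swapEdge_swapEdge hs hx.1
  · intro x hx
    simp only [mem_sigma, mem_univ, true_and, mem_GsetLead] at hx
    exact swapEdge_swapEdge hs hx.1
  · intro x _
    exact (mul_wt_swapEdge q hs x).symm

lemma GsetLead_self {C : Finset S} {t : S} (ht : t ∉ C) : GsetLead C t t = Gset C := by
  ext g
  rw [mem_GsetLead]
  exact and_iff_left ⟨0, rfl, ht, by simp⟩

lemma GsetLead_eq_empty {C : Finset S} {u t : S} (hu : u ∉ C) (hut : u ≠ t) :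
    GsetLead C u t = ∅ := by
  refine eq_empty_of_forall_notMem fun g hg => ?_
  obtain ⟨n, h, -, hC⟩ := (mem_GsetLead.1 hg).2
  cases n with
  | zero => exact hut h
  | succ n => exact hu (hC 0 n.succ_pos)

/-- An irreducible chain has a `C`-graph all of whose edges have positive probability. -/
lemma exists_mem_Gset_forall_pos {q : Matrix S S ℝ} (hq : IsTransition q)
    (hqirr : IsIrreducible q) {C : Finset S} {t : S} (ht : t ∉ C) :
    ∃ g ∈ Gset C, ∀ u ∈ C, 0 < q u (g u) := by
  classical
  have hex : ∀ u, ∃ n, ∃ w ∉ C, 0 < (q ^ n) u w := fun u =>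
    let ⟨n, _, h⟩ := hqirr u t
    ⟨n, t, ht, h⟩
  have hstep : ∀ u, ∃ v, (u ∈ C → 0 < q u v ∧ Nat.find (hex v) < Nat.find (hex u)) ∧
      (u ∉ C → v = u) := by
    intro u
    by_cases hu : u ∈ C
    · obtain ⟨w, hw, hpos⟩ := Nat.find_spec (hex u)
      obtain ⟨n, hn⟩ : ∃ n, Nat.find (hex u) = n + 1 := by
        refine Nat.exists_eq_succ_of_ne_zero fun h0 => ?_
        rw [h0, pow_zero, Matrix.one_apply_ne (by rintro rfl; exact hw hu)] at hpos
        exact hpos.false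
      rw [hn, pow_succ', Matrix.mul_apply] at hpos
      obtain ⟨v, -, hv⟩ := exists_lt_of_sum_lt (f := fun _ => (0 : ℝ)) (by simpa using hpos)
      have hqv : 0 < q u v := (hq.1 u v).lt_of_ne' (left_ne_zero_of_mul hv.ne')
      refine ⟨v, fun _ => ⟨hqv, ?_⟩, fun h => absurd hu h⟩
      rw [hn]
      exact Nat.lt_succ_of_le (Nat.find_min' _ ⟨w, hw, (pos_iff_pos_of_mul_pos hv).1 hqv⟩)
    · exact ⟨u, fun h => absurd h hu, fun _ => rfl⟩
  choose g hg hfix using hstep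
  refine ⟨g, mem_Gset.2 ⟨isCGraph_of_forall_exits fun u => ?_, hfix⟩, fun u hu => (hg u hu).1⟩
  induction hd : Nat.find (hex u) using Nat.strong_induction_on generalizing u with
  | _ d ih =>
    by_cases hu : u ∈ C
    · obtain ⟨n, hn⟩ := ih _ (hd ▸ (hg u hu).2) (g u) rfl
      exact ⟨n + 1, hn⟩
    · exact ⟨0, hu⟩

omit [DecidableEq S] in
lemma wt_nonneg {q : Matrix S S ℝ} (hq : IsTransition q) (C : Finset S) (g : S → S) :
    0 ≤ wt q C g :=
  prod_nonneg fun _ _ => hq.1 _ _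

lemma subMat_nonneg {q : Matrix S S ℝ} (hq : IsTransition q) (C : Finset S) (u v : S) :
    0 ≤ subMat q C u v := by
  unfold subMat
  split_ifs
  exacts [hq.1 u v, le_rfl]

lemma subMat_le {q : Matrix S S ℝ} (hq : IsTransition q) (C : Finset S) (u v : S) :
    subMat q C u v ≤ q u v := by
  unfold subMat
  split_ifs
  exacts [le_rfl, hq.1 u v]

/-- Maximum principle: a nonnegative function harmonic for the killed chain vanishes. -/
lemma eq_zero_of_subMat_mulVec_eq {q : Matrix S S ℝ} (hq : IsTransition q) {C : Finset S}
    {g : S → S} (hg : g ∈ Gset C) (hpos : ∀ u ∈ C, 0 < q u (g u)) {D : S → ℝ}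
    (hD0 : ∀ u, 0 ≤ D u) (hD : subMat q C *ᵥ D = D) : D = 0 := by
  have hout : ∀ u ∉ C, D u = 0 := by
    intro u hu
    rw [← hD]
    simp [Matrix.mulVec, dotProduct, subMat, hu]
  by_cases hne : Nonempty S
  swap
  · exact funext fun u => absurd ⟨u⟩ hne
  obtain ⟨m, hm⟩ := Finite.exists_max D
  have hstep : ∀ u ∈ C, D u = D m → D (g u) = D m := by
    intro u hu hum
    by_contra hcon
    have hlt : D (g u) < D m := (hm _).lt_of_ne hcon
    have h1 : D u ≤ ∑ v, q u v * D v := by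
      conv_lhs => rw [← hD]
      refine sum_le_sum fun v _ => mul_le_mul_of_nonneg_right
        (subMat_le hq C u v) (hD0 v)
    have h2 : ∑ v, q u v * D v < ∑ v, q u v * D m :=
      sum_lt_sum (fun v _ => mul_le_mul_of_nonneg_left (hm v) (hq.1 u v))
        ⟨g u, mem_univ _, mul_lt_mul_of_pos_left hlt (hpos u hu)⟩
    rw [← sum_mul, hq.2, one_mul] at h2
    linarith
  obtain ⟨hac, hfix⟩ := mem_Gset.1 hg
  have hiter : ∀ n, D (g^[n] m) = D m := by
    intro n
    induction n with
    | zero => rfl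
    | succ n ih =>
      rw [Function.iterate_succ_apply']
      by_cases h : g^[n] m ∈ C
      · exact hstep _ h ih
      · rw [hfix _ h, ih]
  obtain ⟨n, hn⟩ := hac.exits m
  have hm0 : D m = 0 := by rw [← hiter n, hout _ hn]
  exact funext fun u => le_antisymm ((hm u).trans_eq hm0) (hD0 u)

omit [DecidableEq S] in
lemma mulVec_nonneg_of_nonneg {P : Matrix S S ℝ} (hP : ∀ u v, 0 ≤ P u v) {h : S → ℝ}
    (hh : ∀ u, 0 ≤ h u) (u : S) : 0 ≤ (P *ᵥ h) u :=
  sum_nonneg fun v _ => mul_nonneg (hP u v) (hh v)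

lemma pow_mulVec_nonneg {P : Matrix S S ℝ} (hP : ∀ u v, 0 ≤ P u v) {h : S → ℝ}
    (hh : ∀ u, 0 ≤ h u) (n : ℕ) (u : S) : 0 ≤ (P ^ n *ᵥ h) u := by
  induction n generalizing u with
  | zero => simpa using hh u
  | succ n ih =>
    rw [pow_succ', ← Matrix.mulVec_mulVec]
    exact mulVec_nonneg_of_nonneg hP ih u

/-- If `h = r + P h` has a nonnegative solution and no nonzero nonnegative vector is fixed by
`P`, then `h` is the sum of the Neumann series. -/
lemma tsum_pow_mulVec_eq {P : Matrix S S ℝ} (hP : ∀ u v, 0 ≤ P u v) {r h : S → ℝ}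
    (hr : ∀ u, 0 ≤ r u) (hh : ∀ u, 0 ≤ h u) (heq : r + P *ᵥ h = h)
    (hmax : ∀ D : S → ℝ, (∀ u, 0 ≤ D u) → P *ᵥ D = D → D = 0) (s : S) :
    ∑' n : ℕ, (P ^ n *ᵥ r) s = h s := by
  have hpart : ∀ n, ∑ k ∈ range n, P ^ k *ᵥ r + P ^ n *ᵥ h = h := by
    intro n
    induction n with
    | zero => simp
    | succ n ih =>
      conv_rhs => rw [← ih, ← heq, Matrix.mulVec_add, Matrix.mulVec_mulVec, ← pow_succ]
      rw [sum_range_succ, add_assoc]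
  have hle : ∀ n u, ∑ k ∈ range n, (P ^ k *ᵥ r) u ≤ h u := by
    intro n u
    have h1 := congrFun (hpart n) u
    rw [Pi.add_apply, Finset.sum_apply] at h1
    linarith [pow_mulVec_nonneg hP hh n u]
  have hsum : ∀ u, Summable fun n : ℕ => (P ^ n *ᵥ r) u := fun u =>
    summable_of_sum_range_le (fun n => pow_mulVec_nonneg hP hr n u) fun n => hle n u
  have hH : ∀ u, ∑' n : ℕ, (P ^ n *ᵥ r) u = r u + ∑ v, P u v * ∑' n : ℕ, (P ^ n *ᵥ r) v := by
    intro u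
    rw [(hsum u).tsum_eq_zero_add]
    simp only [← tsum_mul_left]
    rw [← Summable.tsum_finsetSum fun v _ => (hsum v).mul_left _]
    simp only [pow_zero, Matrix.one_mulVec, pow_succ', ← Matrix.mulVec_mulVec]
    rfl
  have hD := hmax (fun u => h u - ∑' n : ℕ, (P ^ n *ᵥ r) u)
    (fun u => sub_nonneg.2 ((hsum u).tsum_le_of_sum_range_le fun n => hle n u)) (by
      funext u
      have h1 := congrFun heq u
      simp only [Pi.add_apply, Matrix.mulVec, dotProduct] at h1
      have h2 := hH u
      simp only [Matrix.mulVec, dotProduct] at h2 ⊢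
      simp only [mul_sub, sum_sub_distrib]
      linarith)
  exact (sub_eq_zero.1 (congrFun hD s)).symm

/-- Freidlin–Wentzell: the exit distribution is given by
`Q_{s,q}(t|C) = (Σ_{g ∈ G_{s,t}(C)} p(g)) / (Σ_{g ∈ G(C)} p(g))`. -/
theorem exit_distribution_eq_graph_ratio
    (hcard : 2 ≤ Fintype.card S)
    (q : Matrix S S ℝ) (hq : IsTransition q) (hqirr : IsIrreducible q)
    (C : Finset S) (hCne : C.Nonempty) (hCproper : C ≠ Finset.univ)
    (s : S) (hs : s ∈ C) (t : S) (ht : t ∉ C) :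
    exitProb q C s t =
      (∑ g ∈ GsetLead C s t, wt q C g) / ∑ g ∈ Gset C, wt q C g := by
  obtain ⟨g₀, hg₀, hpos⟩ := exists_mem_Gset_forall_pos hq hqirr ht
  have hZ : 0 < ∑ g ∈ Gset C, wt q C g :=
    sum_pos' (fun g _ => wt_nonneg hq C g) ⟨g₀, hg₀, prod_pos hpos⟩
  set Z := ∑ g ∈ Gset C, wt q C g with hZdef
  set r : S → ℝ := fun u => if u ∈ C then q u t else 0 with hr
  set h : S → ℝ := fun u => if u ∈ C then (∑ g ∈ GsetLead C u t, wt q C g) / Z else 0 with hh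
  have hexit : exitProb q C s t = ∑' n : ℕ, (subMat q C ^ n *ᵥ r) s := by
    refine tsum_congr fun n => ?_
    simp [Matrix.mulVec, dotProduct, hr]
  rw [hexit, tsum_pow_mulVec_eq (subMat_nonneg hq C) (h := h) ?_ ?_ ?_
    (fun D => eq_zero_of_subMat_mulVec_eq hq hg₀ hpos)]
  · exact if_pos hs
  · intro u
    simp only [hr]
    split_ifs
    exacts [hq.1 u t, le_rfl]
  · intro u
    simp only [hh]
    split_ifs
    exacts [div_nonneg (sum_nonneg fun g _ => wt_nonneg hq C g) hZ.le, le_rfl]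
  · funext u
    by_cases hu : u ∈ C
    · have hsplit : ∀ v, q u v * ∑ g ∈ GsetLead C v t, wt q C g =
          (if v = t then q u v * Z else 0) + subMat q C u v * h v * Z := by
        intro v
        by_cases hv : v ∈ C
        · have hvt : v ≠ t := by rintro rfl; exact ht hv
          simp only [subMat, hh, hu, hv, hvt, and_self, if_true, if_false, zero_add]
          field_simp
        · by_cases hvt : v = t
          · subst hvt
            simp [subMat, hv, GsetLead_self hv, hZdef]
          · simp [subMat, hv, hvt, GsetLead_eq_empty hv hvt]
      have hharm := sum_mul_sum_GsetLead hq hu ht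
      simp only [hsplit, sum_add_distrib, sum_ite_eq', mem_univ, if_true, ← sum_mul] at hharm
      rw [← add_mul] at hharm
      have : h u = (∑ g ∈ GsetLead C u t, wt q C g) / Z := if_pos hu
      rw [this, ← hharm, mul_div_cancel_right₀ _ hZ.ne']
      simp [hr, hu, Matrix.mulVec, dotProduct]
    · simp [hr, hh, hu, Matrix.mulVec, dotProduct, subMat]

end PerturbedMC
end
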